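/- arXiv:2009.10414 — 2 statements merged into one kernel-verified Lean document; each statement's English description precedes it below -/
import Mathlib

section
/- Let P and P' be 2-dimensional convex polygons in ℝ², i.e., convex hulls of finite sets of points with nonempty interior. If g_P(x) = g_{P'}(x) for all x ∈ ℝ², then P and P' are strongly congruent, i.e., there exist v ∈ ℝ² and ε ∈ {−1, 1} with P' = εP + v. -/
open MeasureTheory

/-- The covariogram of a set `P ⊆ ℝⁿ`: `g_P(x) = λₙ(P ∩ (P + x))`. -/
noncomputable def covariogram {n : ℕ} (P : Set (EuclideanSpace ℝ (Fin n)))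
    (x : EuclideanSpace ℝ (Fin n)) : ℝ :=
  (volume (P ∩ ((fun p => p + x) '' P))).toReal

open Filter Topology

/-- The parameters `t` of the horizontal lines that meet `K` in a chord of length at least `s`. -/
def longChords (K : Set (ℝ × ℝ)) (s : ℝ) : Set ℝ := {t | ∃ r, (r, t) ∈ K ∧ (r - s, t) ∈ K}

theorem volume_inter_shift_Icc (α β s : ℝ) (hs : 0 ≤ s) :
    volume {r : ℝ | r ∈ Set.Icc α β ∧ r - s ∈ Set.Icc α β} = ENNReal.ofReal (β - α - s) := by
  have : {r : ℝ | r ∈ Set.Icc α β ∧ r - s ∈ Set.Icc α β} = Set.Icc (α + s) β := by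
    ext r
    simp only [Set.mem_Icc, Set.mem_ofPred_eq]
    constructor
    · rintro ⟨⟨_, _⟩, _, _⟩; constructor <;> linarith
    · rintro ⟨_, _⟩; refine ⟨⟨?_, ?_⟩, ?_, ?_⟩ <;> linarith
  rw [this, Real.volume_Icc]; congr 1; ring

theorem exists_mem_shift_Icc_iff (α β s : ℝ) (hs : 0 ≤ s) :
    (∃ r, r ∈ Set.Icc α β ∧ r - s ∈ Set.Icc α β) ↔ s ≤ β - α := by
  constructor
  · rintro ⟨r, ⟨_, _⟩, _, _⟩; linarith
  · intro h; exact ⟨β, ⟨by linarith, le_rfl⟩, by linarith, by linarith⟩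

theorem eq_empty_or_Icc_of_isCompact_convex {C : Set ℝ} (hC : IsCompact C) (hc : Convex ℝ C) :
    C = ∅ ∨ ∃ α β, α ≤ β ∧ C = Set.Icc α β := by
  rcases C.eq_empty_or_nonempty with h | h
  · exact Or.inl h
  · refine Or.inr ⟨sInf C, sSup C, ?_, eq_Icc_of_connected_compact ⟨h, hc.isPreconnected⟩ hC⟩
    exact Real.sInf_le_sSup C hC.bddBelow hC.bddAbove

theorem volume_inter_shift_bounds {C : Set ℝ} (hC : IsCompact C) (hc : Convex ℝ C) {s s' : ℝ}
    (hs : 0 ≤ s) (hss : s < s') :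
    (volume {r | r ∈ C ∧ r - s' ∈ C} +
      {_t : Unit | ∃ r, r ∈ C ∧ r - s' ∈ C}.indicator (fun _ => ENNReal.ofReal (s' - s)) ()
        ≤ volume {r | r ∈ C ∧ r - s ∈ C}) ∧
    (volume {r | r ∈ C ∧ r - s ∈ C} ≤ volume {r | r ∈ C ∧ r - s' ∈ C} +
      {_t : Unit | ∃ r, r ∈ C ∧ r - s ∈ C}.indicator (fun _ => ENNReal.ofReal (s' - s)) ()) := by
  rcases eq_empty_or_Icc_of_isCompact_convex hC hc with rfl | ⟨α, β, hab, rfl⟩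
  · simp
  · rw [volume_inter_shift_Icc _ _ _ hs, volume_inter_shift_Icc _ _ _ (hs.trans hss.le)]
    simp only [exists_mem_shift_Icc_iff _ _ _ hs, exists_mem_shift_Icc_iff _ _ _ (hs.trans hss.le)]
    constructor
    · by_cases h : s' ≤ β - α
      · simp only [h, Set.ofPred_true, Set.indicator_univ]
        rw [← ENNReal.ofReal_add (by linarith) (by linarith)]
        apply ENNReal.ofReal_le_ofReal; linarith
      · simp only [h, Set.ofPred_false, Set.indicator_empty, add_zero]
        apply ENNReal.ofReal_le_ofReal; linarith
    · by_cases h : s ≤ β - α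
      · simp only [h, Set.ofPred_true, Set.indicator_univ]
        refine le_trans (ENNReal.ofReal_le_ofReal ?_) ENNReal.ofReal_add_le
        linarith
      · simp only [h, Set.ofPred_false, Set.indicator_empty, add_zero]
        rw [ENNReal.ofReal_of_nonpos (by linarith)]; exact zero_le

theorem isCompact_section {K : Set (ℝ × ℝ)} (hK : IsCompact K) (t : ℝ) :
    IsCompact {r : ℝ | (r, t) ∈ K} := by
  have h : IsCompact (Prod.fst '' (K ∩ {z | z.2 = t})) :=
    (hK.inter_right (isClosed_eq continuous_snd continuous_const)).image continuous_fst
  convert h using 1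
  ext r
  constructor
  · intro h; exact ⟨(r, t), ⟨h, rfl⟩, rfl⟩
  · rintro ⟨⟨a, b⟩, ⟨h, hb⟩, rfl⟩
    simp only [Set.mem_ofPred_eq] at hb ⊢
    rwa [← hb]

theorem convex_section {K : Set (ℝ × ℝ)} (hK : Convex ℝ K) (t : ℝ) :
    Convex ℝ {r : ℝ | (r, t) ∈ K} := by
  intro a ha b hb u v hu hv huv
  have := hK ha hb hu hv huv
  simp only [Prod.smul_mk, Prod.mk_add_mk, smul_eq_mul] at this ⊢
  rw [← add_mul, huv, one_mul] at this
  exact this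

theorem isCompact_inter_shift {K : Set (ℝ × ℝ)} (hK : IsCompact K) (x : ℝ × ℝ) :
    IsCompact {z | z ∈ K ∧ z - x ∈ K} :=
  hK.inter_right (hK.isClosed.preimage (continuous_id.sub continuous_const))

theorem isCompact_longChords {K : Set (ℝ × ℝ)} (hK : IsCompact K) (s : ℝ) :
    IsCompact (longChords K s) := by
  convert (isCompact_inter_shift hK (s, 0)).image continuous_snd using 1
  ext t
  constructor
  · rintro ⟨r, h1, h2⟩; exact ⟨(r, t), ⟨h1, by simpa using h2⟩, rfl⟩
  · rintro ⟨⟨r, t'⟩, ⟨h1, h2⟩, rfl⟩; exact ⟨r, h1, by simpa using h2⟩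

theorem volume_inter_shift_eq_lintegral {K : Set (ℝ × ℝ)} (hK : IsCompact K) (s : ℝ) :
    volume {z : ℝ × ℝ | z ∈ K ∧ z - (s, 0) ∈ K} =
      ∫⁻ t, volume {r : ℝ | r ∈ {r : ℝ | (r, t) ∈ K} ∧ r - s ∈ {r : ℝ | (r, t) ∈ K}} := by
  rw [Measure.volume_eq_prod,
    Measure.prod_apply_symm (isCompact_inter_shift hK (s, 0)).measurableSet]
  simp

theorem volume_longChords_le {K L : Set (ℝ × ℝ)} (hK : IsCompact K) (hL : IsCompact L)
    (hKc : Convex ℝ K) (hLc : Convex ℝ L)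
    (h : ∀ s : ℝ, volume {z : ℝ × ℝ | z ∈ K ∧ z - (s, 0) ∈ K} =
      volume {z : ℝ × ℝ | z ∈ L ∧ z - (s, 0) ∈ L}) {s s' : ℝ} (hs : 0 ≤ s) (hss : s < s') :
    volume (longChords K s') ≤ volume (longChords L s) := by
  have e (M : Set (ℝ × ℝ)) (hM : IsCompact M) (a : ℝ) :
      ∫⁻ t, {t | ∃ r, r ∈ {r : ℝ | (r, t) ∈ M} ∧ r - a ∈ {r : ℝ | (r, t) ∈ M}}.indicator
        (fun _ => ENNReal.ofReal (s' - s)) t =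
          ENNReal.ofReal (s' - s) * volume (longChords M a) := by
    rw [← lintegral_indicator_const (isCompact_longChords hM a).measurableSet]; rfl
  have ind (M : Set (ℝ × ℝ)) (hM : IsCompact M) (a : ℝ) : Measurable
      ({t | ∃ r, r ∈ {r : ℝ | (r, t) ∈ M} ∧ r - a ∈ {r : ℝ | (r, t) ∈ M}}.indicator
        (fun _ => ENNReal.ofReal (s' - s))) :=
    measurable_const.indicator (isCompact_longChords hM a).measurableSet
  have h1 : volume {z : ℝ × ℝ | z ∈ K ∧ z - (s', 0) ∈ K} +
      ENNReal.ofReal (s' - s) * volume (longChords K s') ≤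
      volume {z : ℝ × ℝ | z ∈ K ∧ z - (s, 0) ∈ K} := by
    rw [volume_inter_shift_eq_lintegral hK, volume_inter_shift_eq_lintegral hK, ← e K hK s',
      ← lintegral_add_right _ (ind K hK s')]
    apply lintegral_mono
    intro t
    exact (volume_inter_shift_bounds (isCompact_section hK t) (convex_section hKc t) hs hss).1
  have h2 : volume {z : ℝ × ℝ | z ∈ L ∧ z - (s, 0) ∈ L} ≤
      volume {z : ℝ × ℝ | z ∈ L ∧ z - (s', 0) ∈ L} +
      ENNReal.ofReal (s' - s) * volume (longChords L s) := by
    rw [volume_inter_shift_eq_lintegral hL, volume_inter_shift_eq_lintegral hL, ← e L hL s,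
      ← lintegral_add_right _ (ind L hL s)]
    apply lintegral_mono
    intro t
    exact (volume_inter_shift_bounds (isCompact_section hL t) (convex_section hLc t) hs hss).2
  rw [h s] at h1
  have h3 := h1.trans h2
  rw [h s'] at h3
  have fin : volume {z : ℝ × ℝ | z ∈ L ∧ z - (s', 0) ∈ L} ≠ ⊤ :=
    (isCompact_inter_shift hL _).measure_lt_top.ne
  have h4 := (ENNReal.add_le_add_iff_left fin).1 h3
  exact (ENNReal.mul_le_mul_iff_right (by simpa using hss) ENNReal.ofReal_ne_top).1 h4

theorem volume_longChords_one_le {K L : Set (ℝ × ℝ)} (hK : IsCompact K) (hL : IsCompact L)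
    (hKc : Convex ℝ K) (hLc : Convex ℝ L)
    (h : ∀ s : ℝ, volume {z : ℝ × ℝ | z ∈ K ∧ z - (s, 0) ∈ K} =
      volume {z : ℝ × ℝ | z ∈ L ∧ z - (s, 0) ∈ L}) :
    volume (longChords K 1) ≤ volume (longChords L 1) := by
  have mem (t s : ℝ) (hs : 0 ≤ s) : t ∈ longChords L s ↔
      ∃ α β, {r : ℝ | (r, t) ∈ L} = Set.Icc α β ∧ s ≤ β - α := by
    constructor
    · rintro ⟨r, h1, h2⟩
      rcases eq_empty_or_Icc_of_isCompact_convex (isCompact_section hL t) (convex_section hLc t)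
        with h0 | ⟨α, β, -, h0⟩
      · have : r ∈ {r : ℝ | (r, t) ∈ L} := h1
        rw [h0] at this; exact this.elim
      · have h1' : r ∈ {r : ℝ | (r, t) ∈ L} := h1
        have h2' : r - s ∈ {r : ℝ | (r, t) ∈ L} := h2
        rw [h0] at h1' h2'
        exact ⟨α, β, h0, (exists_mem_shift_Icc_iff α β s hs).1 ⟨r, h1', h2'⟩⟩
    · rintro ⟨α, β, h0, hab⟩
      obtain ⟨r, h1, h2⟩ := (exists_mem_shift_Icc_iff α β s hs).2 hab
      rw [← h0] at h1 h2
      exact ⟨r, h1, h2⟩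
  let a : ℕ → ℝ := fun n => 1 - 1 / ((n : ℝ) + 1)
  have a0 (n : ℕ) : 0 ≤ a n := by
    have : 1 / ((n : ℝ) + 1) ≤ 1 := by
      rw [div_le_one (by positivity)]; linarith [(Nat.cast_nonneg n : (0 : ℝ) ≤ n)]
    simp only [a]; linarith
  have a1 (n : ℕ) : a n < 1 := by
    have : 0 < 1 / ((n : ℝ) + 1) := by positivity
    simp only [a]; linarith
  have amono : Monotone a := by
    intro m n hmn
    simp only [a]
    have := one_div_le_one_div_of_le (a := (m : ℝ) + 1) (b := (n : ℝ) + 1) (by positivity)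
      (by have : (m : ℝ) ≤ n := by exact_mod_cast hmn
          linarith)
    linarith
  have alim : Filter.Tendsto a Filter.atTop (nhds 1) := by
    have := (tendsto_one_div_add_atTop_nhds_zero_nat (𝕜 := ℝ)).const_sub 1
    simpa [a] using this
  have anti : Antitone fun n => longChords L (a n) := by
    intro m n hmn t ht
    obtain ⟨α, β, h0, hab⟩ := (mem t _ (a0 n)).1 ht
    exact (mem t _ (a0 m)).2 ⟨α, β, h0, (amono hmn).trans hab⟩
  have inter : ⋂ n, longChords L (a n) ⊆ longChords L 1 := by
    intro t ht
    rw [Set.mem_iInter] at ht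
    obtain ⟨α, β, h0, hab⟩ := (mem t _ (a0 0)).1 (ht 0)
    refine (mem t 1 zero_le_one).2 ⟨α, β, h0, ?_⟩
    refine le_of_tendsto alim (Filter.Eventually.of_forall fun n => ?_)
    obtain ⟨r, h1, h2⟩ := ht n
    have h1' : r ∈ {r : ℝ | (r, t) ∈ L} := h1
    have h2' : r - a n ∈ {r : ℝ | (r, t) ∈ L} := h2
    rw [h0] at h1' h2'
    exact (exists_mem_shift_Icc_iff α β (a n) (a0 n)).1 ⟨r, h1', h2'⟩
  have lim := tendsto_measure_iInter_atTop (μ := volume)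
    (fun n => (isCompact_longChords hL (a n)).measurableSet.nullMeasurableSet) anti
    ⟨0, (isCompact_longChords hL (a 0)).measure_lt_top.ne⟩
  refine (ge_of_tendsto lim (Filter.Eventually.of_forall fun n => ?_)).trans (measure_mono inter)
  exact volume_longChords_le hK hL hKc hLc h (a0 n) (a1 n)

/-- The oriented area spanned by two plane vectors. -/
def cross (x y : ℝ × ℝ) : ℝ := x.2 * y.1 - x.1 * y.2

/-- The points `b` and `d` are extreme, in the direction transverse to `x`, among the endpoints of
the chords of `K` that are translates of `x`. -/
def IsExt (K : Set (ℝ × ℝ)) (x b d : ℝ × ℝ) : Prop :=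
  b ∈ K ∧ b - x ∈ K ∧ d ∈ K ∧ d - x ∈ K ∧
    ∀ y ∈ K, y - x ∈ K → cross x d ≤ cross x y ∧ cross x y ≤ cross x b

/-- The planar set is not contained in a line. -/
def IsFat (K : Set (ℝ × ℝ)) : Prop :=
  ∀ α β : ℝ, (α ≠ 0 ∨ β ≠ 0) → ∃ y ∈ K, ∃ z ∈ K, α * y.1 + β * y.2 < α * z.1 + β * z.2

/-- The consequences of equality of covariograms of two convex polygons that determine them. -/
structure Homometric (K L : Set (ℝ × ℝ)) : Prop where
  polyK : ∃ V : Set (ℝ × ℝ), V.Finite ∧ K = convexHull ℝ V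
  polyL : ∃ V : Set (ℝ × ℝ), V.Finite ∧ L = convexHull ℝ V
  fatK : IsFat K
  fatL : IsFat L
  diff : ∀ x, (∃ y ∈ K, y - x ∈ K) ↔ (∃ y ∈ L, y - x ∈ L)
  width : ∀ x b d b' d', IsExt K x b d → IsExt L x b' d' →
    cross x b - cross x d = cross x b' - cross x d'

theorem Homometric.symm {K L : Set (ℝ × ℝ)} (h : Homometric K L) : Homometric L K :=
  ⟨h.polyL, h.polyK, h.fatL, h.fatK, fun x => (h.diff x).symm,
    fun x b d b' d' hb hb' => (h.width x b' d' b d hb' hb).symm⟩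

/-- An affine map of the plane in coordinates. -/
def planeMap (p q r s a b : ℝ) : ℝ × ℝ →ᵃ[ℝ] ℝ × ℝ where
  toFun z := (p * z.1 + q * z.2 + a, r * z.1 + s * z.2 + b)
  linear :=
    { toFun := fun z => (p * z.1 + q * z.2, r * z.1 + s * z.2)
      map_add' := fun x y => by ext <;> simp <;> ring
      map_smul' := fun c y => by ext <;> simp <;> ring }
  map_vadd' x y := by ext <;> simp <;> ring

theorem planeMap_apply (p q r s a b : ℝ) (z : ℝ × ℝ) :
    planeMap p q r s a b z = (p * z.1 + q * z.2 + a, r * z.1 + s * z.2 + b) := rfl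

section planeMap

variable {p q r s : ℝ}

theorem planeMap_injective (h : p * s - q * r ≠ 0) (a b : ℝ) :
    Function.Injective (planeMap p q r s a b) := by
  rintro ⟨x1, x2⟩ ⟨y1, y2⟩ hxy
  simp only [planeMap_apply, Prod.mk.injEq] at hxy
  obtain ⟨h1, h2⟩ := hxy
  ext
  · apply mul_left_cancel₀ h; simp only; linear_combination s * h1 - q * h2
  · apply mul_left_cancel₀ h; simp only; linear_combination p * h2 - r * h1

theorem exists_planeMap_zero_eq (h : p * s - q * r ≠ 0) (z : ℝ × ℝ) :
    ∃ x, planeMap p q r s 0 0 x = z := by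
  refine ⟨((s * z.1 - q * z.2) / (p * s - q * r), (p * z.2 - r * z.1) / (p * s - q * r)), ?_⟩
  rw [planeMap_apply]
  generalize hD : p * s - q * r = D at h
  ext
  · simp only; field_simp; rw [← hD]; ring
  · simp only; field_simp; rw [← hD]; ring

theorem planeMap_sub (a b : ℝ) (x y : ℝ × ℝ) :
    planeMap p q r s a b y - planeMap p q r s 0 0 x = planeMap p q r s a b (y - x) := by
  ext <;> simp [planeMap_apply] <;> ring

theorem cross_planeMap (a b : ℝ) (x y : ℝ × ℝ) :
    cross (planeMap p q r s 0 0 x) (planeMap p q r s a b y) =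
      (p * s - q * r) * cross x y + cross (planeMap p q r s 0 0 x) (a, b) := by
  simp only [cross, planeMap_apply]; ring

theorem planeMap_mem_image (h : p * s - q * r ≠ 0) {a b : ℝ} {K : Set (ℝ × ℝ)} {z : ℝ × ℝ} :
    planeMap p q r s a b z ∈ planeMap p q r s a b '' K ↔ z ∈ K :=
  (planeMap_injective h a b).mem_set_image

theorem exists_convexHull_image_planeMap {K : Set (ℝ × ℝ)} (a b : ℝ)
    (h : ∃ V : Set (ℝ × ℝ), V.Finite ∧ K = convexHull ℝ V) :
    ∃ V : Set (ℝ × ℝ), V.Finite ∧ planeMap p q r s a b '' K = convexHull ℝ V := by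
  obtain ⟨V, hV, rfl⟩ := h
  exact ⟨planeMap p q r s a b '' V, hV.image _, AffineMap.image_convexHull _ _⟩

theorem IsFat.image_planeMap {K : Set (ℝ × ℝ)} (hK : IsFat K) (h : p * s - q * r ≠ 0)
    (a b : ℝ) : IsFat (planeMap p q r s a b '' K) := by
  intro α β hαβ
  have : α * p + β * r ≠ 0 ∨ α * q + β * s ≠ 0 := by
    by_contra! hc
    obtain ⟨h1, h2⟩ := hc
    rcases hαβ with h0 | h0
    · apply mul_ne_zero h0 h; linear_combination s * h1 - r * h2
    · apply mul_ne_zero h0 h; linear_combination p * h2 - q * h1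
  obtain ⟨y, hy, z, hz, hyz⟩ := hK _ _ this
  refine ⟨_, Set.mem_image_of_mem _ hy, _, Set.mem_image_of_mem _ hz, ?_⟩
  simp only [planeMap_apply]
  linarith

theorem exists_shift_image_planeMap_iff (h : p * s - q * r ≠ 0) (a b : ℝ) (K : Set (ℝ × ℝ))
    (x : ℝ × ℝ) :
    (∃ y ∈ planeMap p q r s a b '' K,
      y - planeMap p q r s 0 0 x ∈ planeMap p q r s a b '' K) ↔ ∃ y ∈ K, y - x ∈ K := by
  simp only [Set.exists_mem_image, planeMap_sub, planeMap_mem_image h]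

theorem exists_isExt_of_image_planeMap (h : p * s - q * r ≠ 0) {a b : ℝ} {K : Set (ℝ × ℝ)}
    {x y z : ℝ × ℝ}
    (hyz : IsExt (planeMap p q r s a b '' K) (planeMap p q r s 0 0 x) y z) :
    ∃ y' z', y = planeMap p q r s a b y' ∧ z = planeMap p q r s a b z' ∧
      (0 < p * s - q * r → IsExt K x y' z') ∧ (p * s - q * r < 0 → IsExt K x z' y') := by
  obtain ⟨⟨y', hy', rfl⟩, h2, ⟨z', hz', rfl⟩, h4, h5⟩ := hyz
  rw [planeMap_sub, planeMap_mem_image h] at h2 h4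
  have h6 : ∀ y ∈ K, y - x ∈ K → (p * s - q * r) * cross x z' ≤ (p * s - q * r) * cross x y ∧
      (p * s - q * r) * cross x y ≤ (p * s - q * r) * cross x y' := by
    intro w hw hw'
    have := h5 _ (Set.mem_image_of_mem _ hw)
      (by rw [planeMap_sub]; exact Set.mem_image_of_mem _ hw')
    simp only [cross_planeMap a b] at this
    constructor <;> linarith [this.1, this.2]
  refine ⟨y', z', rfl, rfl, fun hd => ⟨hy', h2, hz', h4, fun w hw hw' => ?_⟩,
    fun hd => ⟨hz', h4, hy', h2, fun w hw hw' => ?_⟩⟩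
  · exact ⟨le_of_mul_le_mul_left (h6 w hw hw').1 hd, le_of_mul_le_mul_left (h6 w hw hw').2 hd⟩
  · exact ⟨(mul_le_mul_left_of_neg hd).1 (h6 w hw hw').2,
      (mul_le_mul_left_of_neg hd).1 (h6 w hw hw').1⟩

theorem Homometric.image_planeMap {K L : Set (ℝ × ℝ)} (hKL : Homometric K L)
    (h : p * s - q * r ≠ 0) (a b a' b' : ℝ) :
    Homometric (planeMap p q r s a b '' K) ((planeMap p q r s a' b') '' L) where
  polyK := exists_convexHull_image_planeMap a b hKL.polyK
  polyL := exists_convexHull_image_planeMap a' b' hKL.polyL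
  fatK := hKL.fatK.image_planeMap h a b
  fatL := hKL.fatL.image_planeMap h a' b'
  diff z := by
    obtain ⟨x, rfl⟩ := exists_planeMap_zero_eq h z
    rw [exists_shift_image_planeMap_iff h, exists_shift_image_planeMap_iff h, hKL.diff]
  width z y y' w w' h1 h2 := by
    obtain ⟨x, rfl⟩ := exists_planeMap_zero_eq h z
    obtain ⟨y, y', rfl, rfl, hp, hn⟩ := exists_isExt_of_image_planeMap h h1
    obtain ⟨w, w', rfl, rfl, hp', hn'⟩ := exists_isExt_of_image_planeMap h h2
    have : cross x y - cross x y' = cross x w - cross x w' := by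
      rcases h.lt_or_gt with hd | hd
      · linarith [hKL.width x _ _ _ _ (hn hd) (hn' hd)]
      · exact hKL.width x _ _ _ _ (hp hd) (hp' hd)
    simp only [cross_planeMap a b, cross_planeMap a' b']
    linear_combination (p * s - q * r) * this

end planeMap

theorem Homometric.convexK {K L : Set (ℝ × ℝ)} (h : Homometric K L) : Convex ℝ K := by
  obtain ⟨V, _, rfl⟩ := h.polyK
  exact convex_convexHull ℝ V

theorem Homometric.isCompactK {K L : Set (ℝ × ℝ)} (h : Homometric K L) : IsCompact K := by
  obtain ⟨V, hV, rfl⟩ := h.polyK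
  exact hV.isCompact_convexHull ℝ

/-- The top face of `K` is the segment from `(α, H)` to `(β, H)`. -/
def TopFace (K : Set (ℝ × ℝ)) (H α β : ℝ) : Prop :=
  α ≤ β ∧ (∀ y ∈ K, y.2 ≤ H) ∧ ∀ t, (t, H) ∈ K ↔ α ≤ t ∧ t ≤ β

/-- The bottom face of `K` is the segment from `(α, G)` to `(β, G)`. -/
def BotFace (K : Set (ℝ × ℝ)) (G α β : ℝ) : Prop :=
  α ≤ β ∧ (∀ y ∈ K, G ≤ y.2) ∧ ∀ t, (t, G) ∈ K ↔ α ≤ t ∧ t ≤ β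

theorem Homometric.nonemptyK {K L : Set (ℝ × ℝ)} (h : Homometric K L) : K.Nonempty := by
  obtain ⟨y, hy, -⟩ := h.fatK 1 0 (by simp)
  exact ⟨y, hy⟩

theorem exists_section_eq_Icc {K : Set (ℝ × ℝ)} (hK : IsCompact K) (hKc : Convex ℝ K)
    {y : ℝ × ℝ} (hy : y ∈ K) :
    ∃ α β, α ≤ β ∧ ∀ t, (t, y.2) ∈ K ↔ α ≤ t ∧ t ≤ β := by
  rcases eq_empty_or_Icc_of_isCompact_convex (isCompact_section hK y.2)
    (convex_section hKc y.2) with h | ⟨α, β, hab, h⟩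
  · exact absurd (show y.1 ∈ {r | (r, y.2) ∈ K} from hy) (by rw [h]; simp)
  · exact ⟨α, β, hab, fun t => Set.ext_iff.1 h t⟩

theorem exists_topFace {K : Set (ℝ × ℝ)} (hK : IsCompact K) (hKc : Convex ℝ K)
    (hne : K.Nonempty) : ∃ H α β, TopFace K H α β := by
  obtain ⟨y, hy, hmax⟩ := hK.exists_isMaxOn hne (continuous_snd.continuousOn)
  obtain ⟨α, β, hab, h⟩ := exists_section_eq_Icc hK hKc hy
  exact ⟨y.2, α, β, hab, fun z hz => hmax hz, h⟩

theorem exists_botFace {K : Set (ℝ × ℝ)} (hK : IsCompact K) (hKc : Convex ℝ K)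
    (hne : K.Nonempty) : ∃ G α β, BotFace K G α β := by
  obtain ⟨y, hy, hmin⟩ := hK.exists_isMinOn hne (continuous_snd.continuousOn)
  obtain ⟨α, β, hab, h⟩ := exists_section_eq_Icc hK hKc hy
  exact ⟨y.2, α, β, hab, fun z hz => hmin hz, h⟩

section faces

variable {K L : Set (ℝ × ℝ)} {H α₁ α₂ G β₁ β₂ H' α₁' α₂' G' β₁' β₂' : ℝ}

theorem Homometric.height_le (hKL : Homometric K L) (ht : TopFace K H α₁ α₂)
    (hb : BotFace K G β₁ β₂) (ht' : TopFace L H' α₁' α₂') (hb' : BotFace L G' β₁' β₂') :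
    H - G ≤ H' - G' := by
  obtain ⟨y, hy, hyx⟩ := (hKL.diff (α₁ - β₁, H - G)).1
    ⟨(α₁, H), (ht.2.2 _).2 ⟨le_rfl, ht.1⟩, by
      have := (hb.2.2 _).2 ⟨le_rfl, hb.1⟩
      convert this using 1; ext <;> simp⟩
  have h1 := ht'.2.1 y hy
  have h2 := hb'.2.1 _ hyx
  simp only [Prod.snd_sub] at h2
  linarith

theorem Homometric.height_eq (hKL : Homometric K L) (ht : TopFace K H α₁ α₂)
    (hb : BotFace K G β₁ β₂) (ht' : TopFace L H' α₁' α₂') (hb' : BotFace L G' β₁' β₂') :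
    H - G = H' - G' :=
  le_antisymm (hKL.height_le ht hb ht' hb') (hKL.symm.height_le ht' hb' ht hb)

theorem Homometric.face_bounds (hKL : Homometric K L) (ht : TopFace K H α₁ α₂)
    (hb : BotFace K G β₁ β₂) (ht' : TopFace L H' α₁' α₂') (hb' : BotFace L G' β₁' β₂')
    {a b : ℝ} (ha : α₁ ≤ a ∧ a ≤ α₂) (hb0 : β₁ ≤ b ∧ b ≤ β₂) :
    α₁' - β₂' ≤ a - b ∧ a - b ≤ α₂' - β₁' := by
  have hH := hKL.height_eq ht hb ht' hb'
  obtain ⟨y, hy, hyx⟩ := (hKL.diff (a - b, H - G)).1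
    ⟨(a, H), (ht.2.2 _).2 ha, by
      have := (hb.2.2 _).2 hb0
      convert this using 1; ext <;> simp⟩
  have h1 := ht'.2.1 y hy
  have h2 := hb'.2.1 _ hyx
  simp only [Prod.snd_sub] at h2
  have h3 : y.2 = H' := by linarith
  have h4 := (ht'.2.2 y.1).1 (by rw [← h3]; exact hy)
  have h5 := (hb'.2.2 (y.1 - (a - b))).1 (by
    convert hyx using 1; ext <;> simp; linarith)
  constructor <;> linarith [h4.1, h4.2, h5.1, h5.2]

theorem Homometric.face_ends_eq (hKL : Homometric K L) (ht : TopFace K H α₁ α₂)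
    (hb : BotFace K G β₁ β₂) (ht' : TopFace L H' α₁' α₂') (hb' : BotFace L G' β₁' β₂') :
    α₁ - β₂ = α₁' - β₂' ∧ α₂ - β₁ = α₂' - β₁' := by
  have h1 := hKL.face_bounds ht hb ht' hb' ⟨le_rfl, ht.1⟩ ⟨hb.1, le_rfl⟩
  have h2 := hKL.face_bounds ht hb ht' hb' ⟨ht.1, le_rfl⟩ ⟨le_rfl, hb.1⟩
  have h3 := hKL.symm.face_bounds ht' hb' ht hb ⟨le_rfl, ht'.1⟩ ⟨hb'.1, le_rfl⟩
  have h4 := hKL.symm.face_bounds ht' hb' ht hb ⟨ht'.1, le_rfl⟩ ⟨le_rfl, hb'.1⟩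
  constructor <;> linarith [h1.1, h2.2, h3.1, h4.2]

theorem isExt_of_topFace_of_botFace (ht : TopFace K H α₁ α₂) (hb : BotFace K G β₁ β₂) (hGH : G ≤ H)
    {σ : ℝ} (hσ : 0 ≤ σ) (hσ' : σ ≤ (α₂ - α₁) + (β₂ - β₁)) :
    IsExt K (α₁ - β₂ + σ, H - G) (α₁ + min (α₂ - α₁) σ, H)
      (α₁ + max 0 (σ - (β₂ - β₁)), H) := by
  have ha := ht.1
  have hb1 := hb.1
  have key : ∀ t : ℝ, max 0 (σ - (β₂ - β₁)) ≤ t → t ≤ min (α₂ - α₁) σ →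
      (α₁ + t, H) ∈ K ∧ (α₁ + t, H) - (α₁ - β₂ + σ, H - G) ∈ K := by
    intro t h1 h2
    rw [max_le_iff] at h1
    rw [le_min_iff] at h2
    refine ⟨(ht.2.2 _).2 ⟨by linarith, by linarith⟩, ?_⟩
    have := (hb.2.2 (α₁ + t - (α₁ - β₂ + σ))).2 ⟨by linarith, by linarith⟩
    convert this using 1; ext <;> simp
  have hle : max 0 (σ - (β₂ - β₁)) ≤ min (α₂ - α₁) σ :=
    max_le (le_min (by linarith) hσ) (le_min (by linarith) (by linarith))
  refine ⟨(key _ hle le_rfl).1, (key _ hle le_rfl).2, (key _ le_rfl hle).1,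
    (key _ le_rfl hle).2, ?_⟩
  rintro ⟨y1, y2⟩ hy hyx
  have h1 := ht.2.1 _ hy
  have h2 := hb.2.1 _ hyx
  simp only [Prod.mk_sub_mk] at h1 h2 hyx
  obtain rfl : y2 = H := by linarith
  have h4 := (ht.2.2 y1).1 hy
  have h5 := (hb.2.2 (y1 - (α₁ - β₂ + σ))).1 (by convert hyx using 2; ring)
  have h6 : max 0 (σ - (β₂ - β₁)) ≤ y1 - α₁ := max_le (by linarith) (by linarith)
  have h7 : y1 - α₁ ≤ min (α₂ - α₁) σ := le_min (by linarith) (by linarith)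
  simp only [cross]
  constructor <;> nlinarith

theorem Homometric.height_pos (hKL : Homometric K L) (ht : TopFace K H α₁ α₂)
    (hb : BotFace K G β₁ β₂) : G < H := by
  obtain ⟨y, hy, z, hz, h⟩ := hKL.fatK 0 1 (by simp)
  have := hb.2.1 y hy
  have := ht.2.1 z hz
  linarith

theorem Homometric.min_face_le (hKL : Homometric K L) (ht : TopFace K H α₁ α₂)
    (hb : BotFace K G β₁ β₂) (ht' : TopFace L H' α₁' α₂') (hb' : BotFace L G' β₁' β₂') :
    min (α₂ - α₁) (β₂ - β₁) ≤ min (α₂' - α₁') (β₂' - β₁') := by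
  have ha := ht.1
  have hb1 := hb.1
  obtain ⟨e1, e2⟩ := hKL.face_ends_eq ht hb ht' hb'
  have eH := hKL.height_eq ht hb ht' hb'
  have hGH := hKL.height_pos ht hb
  set σ := min (α₂ - α₁) (β₂ - β₁) with hσ
  have hσ0 : 0 ≤ σ := le_min (by linarith) (by linarith)
  have hσa : σ ≤ α₂ - α₁ := min_le_left _ _
  have hσb : σ ≤ β₂ - β₁ := min_le_right _ _
  have h1 := isExt_of_topFace_of_botFace ht hb hGH.le hσ0 (by linarith)
  have h2 := isExt_of_topFace_of_botFace ht' hb' (by linarith) hσ0 (by linarith)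
  rw [← e1, ← eH] at h2
  have h3 := hKL.width _ _ _ _ _ h1 h2
  simp only [cross] at h3
  have h4 : min (α₂ - α₁) σ - max 0 (σ - (β₂ - β₁)) =
      min (α₂' - α₁') σ - max 0 (σ - (β₂' - β₁')) := by
    apply mul_left_cancel₀ (sub_ne_zero.2 hGH.ne'); linarith
  rw [min_eq_right hσa, max_eq_left (by linarith)] at h4
  refine le_min ?_ ?_
  · linarith [min_le_left (α₂' - α₁') σ, le_max_left 0 (σ - (β₂' - β₁'))]
  · have h5 := le_max_right 0 (σ - (β₂' - β₁'))
    have h6 := min_le_right (α₂' - α₁') σ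
    linarith only [hσa, h4, h5, h6]

/-- The top face of `K` has the same length as one of the horizontal faces of `L`. -/
theorem Homometric.face_length (hKL : Homometric K L) (ht : TopFace K H α₁ α₂)
    (hb : BotFace K G β₁ β₂) (ht' : TopFace L H' α₁' α₂') (hb' : BotFace L G' β₁' β₂') :
    α₂ - α₁ = α₂' - α₁' ∨ α₂ - α₁ = β₂' - β₁' := by
  obtain ⟨e1, e2⟩ := hKL.face_ends_eq ht hb ht' hb'
  have h1 := hKL.min_face_le ht hb ht' hb'
  have h2 := hKL.symm.min_face_le ht' hb' ht hb
  have h3 := le_antisymm h1 h2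
  rcases min_choice (α₂ - α₁) (β₂ - β₁) with h | h <;>
  rcases min_choice (α₂' - α₁') (β₂' - β₁') with h' | h' <;> rw [h, h'] at h3
  · left; linarith
  · right; linarith
  · right; linarith
  · left; linarith

/-- A horizontal vector that fits into the top face of `L` fits into the top face or into the
bottom face of `K`. -/
theorem Homometric.exists_mem_face (hKL : Homometric K L) {t d h : ℝ} (hd : 0 ≤ d)
    (h1 : (t, h) ∈ L) (h2 : (t + d, h) ∈ L) (hmax : ∀ y ∈ L, y.2 ≤ h) :
    ∃ y ∈ K, (y.1 + d, y.2) ∈ K ∧ ((∀ z ∈ K, z.2 ≤ y.2) ∨ (∀ z ∈ K, y.2 ≤ z.2)) := by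
  obtain ⟨H, α₁, α₂, ht⟩ := exists_topFace hKL.isCompactK hKL.convexK hKL.nonemptyK
  obtain ⟨G, β₁, β₂, hb⟩ := exists_botFace hKL.isCompactK hKL.convexK hKL.nonemptyK
  obtain ⟨H', α₁', α₂', ht'⟩ :=
    exists_topFace hKL.symm.isCompactK hKL.symm.convexK hKL.symm.nonemptyK
  obtain ⟨G', β₁', β₂', hb'⟩ :=
    exists_botFace hKL.symm.isCompactK hKL.symm.convexK hKL.symm.nonemptyK
  obtain rfl : h = H' := le_antisymm (ht'.2.1 _ h1)
    (hmax _ ((ht'.2.2 α₁').2 ⟨le_rfl, ht'.1⟩))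
  have h3 := (ht'.2.2 _).1 h1
  have h4 := (ht'.2.2 _).1 h2
  rcases hKL.symm.face_length ht' hb' ht hb with h5 | h5
  · exact ⟨(α₁, H), (ht.2.2 _).2 ⟨le_rfl, ht.1⟩,
      (ht.2.2 _).2 ⟨by linarith, by linarith⟩, Or.inl ht.2.1⟩
  · exact ⟨(β₁, G), (hb.2.2 _).2 ⟨le_rfl, hb.1⟩,
      (hb.2.2 _).2 ⟨by linarith, by linarith⟩, Or.inr hb.2.1⟩

end faces

theorem convexHull_le_of_forall {V : Set (ℝ × ℝ)} {a b c : ℝ}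
    (h : ∀ v ∈ V, a * v.1 + b * v.2 ≤ c) : ∀ y ∈ convexHull ℝ V, a * y.1 + b * y.2 ≤ c := by
  have hc : Convex ℝ {y : ℝ × ℝ | a * y.1 + b * y.2 ≤ c} :=
    convex_halfSpace_le ⟨fun x y => by simp; ring, fun c x => by simp; ring⟩ c
  exact fun y hy => convexHull_min h hc hy

/-- At the lower end `c` of the face of a polygon where `a` is maximal, the polygon has an edge
along which `a` decreases at a finite rate with respect to `b`. -/
theorem exists_edge {K : Set (ℝ × ℝ)}
    (hK : ∃ V : Set (ℝ × ℝ), V.Finite ∧ K = convexHull ℝ V) {a₁ a₂ b₁ b₂ : ℝ} {c : ℝ × ℝ}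
    (hc : c ∈ K) (hmax : ∀ y ∈ K, a₁ * y.1 + a₂ * y.2 ≤ a₁ * c.1 + a₂ * c.2)
    (hface : ∀ y ∈ K, a₁ * y.1 + a₂ * y.2 = a₁ * c.1 + a₂ * c.2 →
      b₁ * c.1 + b₂ * c.2 ≤ b₁ * y.1 + b₂ * y.2)
    (hlt : ∃ y ∈ K, b₁ * y.1 + b₂ * y.2 < b₁ * c.1 + b₂ * c.2) :
    ∃ μ > 0, ∃ τ > 0, ∃ n : ℝ × ℝ, a₁ * n.1 + a₂ * n.2 = -μ ∧ b₁ * n.1 + b₂ * n.2 = -1 ∧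
      (∀ t, 0 ≤ t → t ≤ τ → (c.1 + t * n.1, c.2 + t * n.2) ∈ K) ∧
      ∀ y ∈ K, a₁ * y.1 + a₂ * y.2 - μ * (b₁ * y.1 + b₂ * y.2) ≤
        a₁ * c.1 + a₂ * c.2 - μ * (b₁ * c.1 + b₂ * c.2) := by
  obtain ⟨V, hV, rfl⟩ := hK
  set a : ℝ × ℝ → ℝ := fun y => a₁ * y.1 + a₂ * y.2 with ha
  set b : ℝ × ℝ → ℝ := fun y => b₁ * y.1 + b₂ * y.2 with hb
  have hVK := subset_convexHull ℝ V
  have hne : ({v ∈ V | b v < b c} : Set (ℝ × ℝ)).Nonempty := by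
    by_contra hcon
    rw [Set.not_nonempty_iff_eq_empty, Set.eq_empty_iff_forall_notMem] at hcon
    obtain ⟨y, hy, hlt⟩ := hlt
    have := convexHull_le_of_forall (V := V) (a := -b₁) (b := -b₂) (c := -b c) (by
      intro v hv
      have : ¬ b v < b c := fun h => hcon v ⟨hv, h⟩
      simp only [hb, not_lt] at this ⊢
      linarith) y hy
    simp only [hb] at this
    linarith
  obtain ⟨n, ⟨hnV, hn⟩, hmin⟩ := Set.exists_min_image _ (fun v => (a c - a v) / (b c - b v))
    (hV.subset (Set.sep_subset V _)) hne
  have hbn : 0 < b c - b n := by linarith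
  have han : 0 < a c - a n := by
    rcases (hmax n (hVK hnV)).lt_or_eq with h | h
    · simp only [ha]; linarith
    · exact absurd (hface n (hVK hnV) h) (not_le.2 hn)
  set μ := (a c - a n) / (b c - b n) with hμ
  have hμ0 : 0 < μ := div_pos han hbn
  have hμn : μ * (b c - b n) = a c - a n := by rw [hμ]; field_simp
  refine ⟨μ, hμ0, b c - b n, hbn,
    ((n.1 - c.1) / (b c - b n), (n.2 - c.2) / (b c - b n)), ?_, ?_, ?_, ?_⟩
  · have : a₁ * (n.1 - c.1) + a₂ * (n.2 - c.2) = -(a c - a n) := by simp only [ha]; ring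
    rw [hμ, ← neg_div, ← this]; ring
  · have : b₁ * (n.1 - c.1) + b₂ * (n.2 - c.2) = -(b c - b n) := by simp only [hb]; ring
    rw [← div_self hbn.ne', ← neg_div, ← this]; ring
  · intro t ht0 ht
    have h := convex_convexHull ℝ V hc (hVK hnV)
      (a := 1 - t / (b c - b n)) (b := t / (b c - b n))
      (by rw [sub_nonneg, div_le_one hbn]; exact ht) (by positivity) (by ring)
    convert h using 1
    ext <;> simp <;> ring
  · have := convexHull_le_of_forall (V := V) (a := a₁ - μ * b₁) (b := a₂ - μ * b₂)
      (c := a c - μ * b c) (by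
        intro v hv
        have hav := hmax v (hVK hv)
        by_cases hbv : b v < b c
        · have h := hmin v ⟨hv, hbv⟩
          rw [le_div_iff₀ (by linarith)] at h
          simp only [ha, hb] at h ⊢
          linarith
        · have h : 0 ≤ μ * (b v - b c) := mul_nonneg hμ0.le (by linarith)
          simp only [ha, hb] at h hav ⊢
          linarith)
    intro y hy
    have := this y hy
    simp only [ha, hb] at this
    linarith

theorem mem_of_mem_horizontal {K : Set (ℝ × ℝ)} (hK : Convex ℝ K) {t a b h : ℝ}
    (ha : (a, h) ∈ K) (hb : (b, h) ∈ K) (h1 : a ≤ t) (h2 : t ≤ b) : (t, h) ∈ K :=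
  (convex_section hK h).ordConnected.out ha hb ⟨h1, h2⟩

theorem mem_of_mem_vertical {K : Set (ℝ × ℝ)} (hK : Convex ℝ K) {t a b h : ℝ}
    (ha : (h, a) ∈ K) (hb : (h, b) ∈ K) (h1 : a ≤ t) (h2 : t ≤ b) : (h, t) ∈ K := by
  have hc : Convex ℝ {r : ℝ | (h, r) ∈ K} := by
    intro x hx y hy u v hu hv huv
    have := hK hx hy hu hv huv
    simp only [Prod.smul_mk, Prod.mk_add_mk, smul_eq_mul] at this ⊢
    rw [← add_mul, huv, one_mul] at this
    exact this
  exact hc.ordConnected.out ha hb ⟨h1, h2⟩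

/-- A vector `(1, 1)` in the face of `L` with normal `(-1, 1)` fits into one of the faces of `K`
with that normal direction. -/
theorem Homometric.exists_mem_diagonal_face {K L : Set (ℝ × ℝ)} (hKL : Homometric K L)
    {a b : ℝ} (h1 : (a, b) ∈ L) (h2 : (a + 1, b + 1) ∈ L) (hmax : ∀ y ∈ L, y.2 - y.1 ≤ b - a) :
    ∃ y ∈ K, (y.1 + 1, y.2 + 1) ∈ K ∧
      ((∀ z ∈ K, z.2 - z.1 ≤ y.2 - y.1) ∨ (∀ z ∈ K, y.2 - y.1 ≤ z.2 - z.1)) := by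
  have hdet : (1 : ℝ) * 1 - 0 * (-1) ≠ 0 := by norm_num
  have h := hKL.image_planeMap hdet 0 0 0 0
  obtain ⟨y', ⟨y, hy, rfl⟩, hy2, hy3⟩ := h.exists_mem_face (t := a) (h := b - a) zero_le_one
    ⟨(a, b), h1, by simp [planeMap_apply]; ring⟩
    ⟨(a + 1, b + 1), h2, by simp [planeMap_apply]; ring⟩
    (by
      rintro _ ⟨y, hy, rfl⟩
      have := hmax y hy
      simp only [planeMap_apply]
      linarith)
  refine ⟨y, hy, ?_, ?_⟩
  · rw [← planeMap_mem_image hdet (a := 0) (b := 0)]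
    convert hy2 using 1
    ext <;> simp [planeMap_apply]
    ring
  · refine hy3.imp (fun h z hz => ?_) (fun h z hz => ?_) <;>
    · have := h _ (Set.mem_image_of_mem _ hz)
      simp only [planeMap_apply] at this
      linarith

/-- The data of a homometric pair of polygons at the corner where four faces alternate between
agreeing and disagreeing. -/
structure CornerPair (K L : Set (ℝ × ℝ)) (H₁ H₂ κ : ℝ) : Prop where
  homo : Homometric K L
  pos : 0 < κ
  boxK : ∀ z ∈ K, -H₁ ≤ z.1 ∧ z.1 ≤ H₁ ∧ -H₂ ≤ z.2 ∧ z.2 ≤ H₂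
  boxL : ∀ z ∈ L, -H₁ ≤ z.1 ∧ z.1 ≤ H₁ ∧ -H₂ ≤ z.2 ∧ z.2 ≤ H₂
  rightK : ∀ z ∈ K, z.1 = H₁ → 1 - H₂ ≤ z.2
  topK : ∀ z ∈ K, z.2 = H₂ → 1 - H₁ ≤ z.1
  leftL : ∀ z ∈ L, z.1 = -H₁ → z.2 ≤ H₂ - 1
  topL : ∀ z ∈ L, z.2 = H₂ → 1 - H₁ ≤ z.1
  memK₁ : (H₁, 1 - H₂) ∈ K
  memK₂ : (1 - H₁, H₂) ∈ K
  memK₃ : (-H₁, H₂ - 1) ∈ K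
  memK₄ : (H₁ - 1, -H₂) ∈ K
  memK₅ : (-H₁, H₂ - 1 + κ) ∈ K
  memK₆ : (H₁ - 1 + κ, -H₂) ∈ K
  memL₁ : (H₁, 1 - H₂) ∈ L
  memL₂ : (H₁, 1 - H₂ - κ) ∈ L
  memL₃ : (-H₁, H₂ - 1) ∈ L
  memL₄ : (1 - H₁, H₂) ∈ L
  memL₅ : (H₁ - 1, -H₂) ∈ L
  memL₆ : (H₁ - 1 + κ, -H₂) ∈ L

namespace CornerPair

variable {K L : Set (ℝ × ℝ)} {H₁ H₂ κ : ℝ}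

theorem not_diagonal (h : CornerPair K L H₁ H₂ κ)
    (hmax : ∀ y ∈ L, y.2 - y.1 ≤ H₂ - 1 - -H₁) : False := by
  have hκ := h.pos
  obtain ⟨y, hy, hy1, hy2⟩ := h.homo.exists_mem_diagonal_face h.memL₃
    (by convert h.memL₄ using 2 <;> ring) hmax
  have b1 := h.boxK _ hy
  have b2 := h.boxK _ hy1
  simp only at b2
  rcases hy2 with hy2 | hy2
  · have := hy2 _ h.memK₅
    simp only at this
    linarith [b1.1, b2.2.2.2]
  · have := hy2 _ h.memK₆
    simp only at this
    linarith [b1.2.2.1, b2.2.1]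

theorem isExt_K (h : CornerPair K L H₁ H₂ κ) {m n e₁ e₂ : ℝ}
    (hb_m : ∀ y ∈ K, y.1 - m * y.2 ≤ H₁ - m * (1 - H₂))
    (hb_n : ∀ y ∈ K, y.2 - n * y.1 ≤ H₂ - n * (1 - H₁))
    (hmem_m : (H₁ + 2 * e₂ * -m, 1 - H₂ + 2 * e₂ * -1) ∈ K)
    (hmem_n : (1 - H₁ + 2 * e₁ * -1, H₂ + 2 * e₁ * -n) ∈ K)
    (h1 : 0 ≤ 1 - 2 * e₁) (h2 : 0 ≤ 1 - 2 * e₂)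
    (hm2 : 0 ≤ e₁ - m * e₂) (hm2' : 2 * (e₁ - m * e₂) ≤ κ)
    (hn2 : 0 ≤ e₂ - n * e₁) (hn2' : 2 * (e₂ - n * e₁) ≤ κ)
    (hm3 : m * (1 - 2 * e₂) ≤ 1 - 2 * e₁) (hn3 : n * (1 - 2 * e₁) ≤ 1 - 2 * e₂) :
    IsExt K (1 - 2 * e₁, 1 - 2 * e₂)
      (H₁ + 2 * e₂ * -m, 1 - H₂ + 2 * e₂ * -1) (1 - H₁ + 2 * e₁ * -1, H₂ + 2 * e₁ * -n) := by
  have hKc := h.homo.convexK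
  refine ⟨hmem_m, ?_, hmem_n, ?_, ?_⟩
  · convert mem_of_mem_horizontal hKc h.memK₄ h.memK₆
      (t := H₁ - 1 + 2 * (e₁ - m * e₂)) (by linarith) (by linarith) using 1
    ext <;> simp <;> ring
  · convert mem_of_mem_vertical hKc h.memK₃ h.memK₅
      (t := H₂ - 1 + 2 * (e₂ - n * e₁)) (by linarith) (by linarith) using 1
    ext <;> simp <;> ring
  · rintro ⟨X, Y⟩ hy hyx
    have b1 := h.boxK _ hyx
    have b2 := hb_m _ hy
    have b3 := hb_n _ hy
    simp only [cross, Prod.fst_sub, Prod.snd_sub] at b1 b2 b3 ⊢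
    obtain ⟨bX, -, bY, -⟩ := b1
    have c1 : 0 ≤ ((1 - 2 * e₁) - m * (1 - 2 * e₂)) *
        (Y - (1 - 2 * e₂) - -H₂) := mul_nonneg (by linarith) (by linarith)
    have c2 : 0 ≤ ((1 - 2 * e₂) - n * (1 - 2 * e₁)) *
        (X - (1 - 2 * e₁) - -H₁) := mul_nonneg (by linarith) (by linarith)
    have c3 := mul_le_mul_of_nonneg_left b2 h2
    have c4 := mul_le_mul_of_nonneg_left b3 h1
    constructor <;> linarith

theorem isExt_L (h : CornerPair K L H₁ H₂ κ) {p q e₁ e₂ s s' : ℝ}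
    (hb_p : ∀ y ∈ L, -y.1 + p * y.2 ≤ H₁ + p * (H₂ - 1))
    (hb_q : ∀ y ∈ L, y.2 - q * y.1 ≤ H₂ - q * (1 - H₁))
    (hmem_p : (-H₁ + s' * p, H₂ - 1 + s' * 1) ∈ L)
    (hmem_q : (1 - H₁ + s * -1, H₂ + s * -q) ∈ L)
    (hD : 0 < 1 - p * q) (hs : 2 * e₁ - s = s' * p) (hs' : 2 * e₂ - s * q = s')
    (h1 : 0 ≤ 1 - 2 * e₁) (h2 : 0 ≤ 1 - 2 * e₂)
    (he1 : 0 ≤ e₁) (he1' : 2 * e₁ ≤ κ) (he2 : 0 ≤ e₂) (he2' : 2 * e₂ ≤ κ)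
    (hp3 : p * (1 - 2 * e₂) ≤ 1 - 2 * e₁) (hq3 : q * (1 - 2 * e₁) ≤ 1 - 2 * e₂) :
    IsExt L (1 - 2 * e₁, 1 - 2 * e₂)
      (H₁, 1 - H₂ - 2 * e₂) (1 - H₁ + s * -1, H₂ + s * -q) := by
  have hLc := h.homo.symm.convexK
  refine ⟨mem_of_mem_vertical hLc h.memL₂ h.memL₁ (by linarith) (by linarith), ?_,
    hmem_q, ?_, ?_⟩
  · convert mem_of_mem_horizontal hLc h.memL₅ h.memL₆
      (t := H₁ - 1 + 2 * e₁) (by linarith) (by linarith) using 1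
    ext <;> simp
    ring
  · convert hmem_p using 1
    ext
    · simp; linarith
    · simp; linarith
  · rintro ⟨X, Y⟩ hy hyx
    have b1 := (h.boxL _ hyx).2.2.1
    have b1' := (h.boxL _ hy).2.1
    have b2 := hb_p _ hyx
    have b3 := hb_q _ hy
    simp only [cross, Prod.fst_sub, Prod.snd_sub] at b1 b1' b2 b3 ⊢
    have c1 : 0 ≤ (1 - 2 * e₁) * (Y - (1 - 2 * e₂) - -H₂) :=
      mul_nonneg (by linarith) (by linarith)
    have c2 : 0 ≤ (1 - 2 * e₂) * (H₁ - X) := mul_nonneg (by linarith) (by linarith)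
    have c3 := mul_le_mul_of_nonneg_left b2
      (show 0 ≤ (1 - 2 * e₂) - q * (1 - 2 * e₁) by linarith)
    have c4 := mul_le_mul_of_nonneg_left b3
      (show 0 ≤ (1 - 2 * e₁) - p * (1 - 2 * e₂) by linarith)
    refine ⟨?_, by linarith⟩
    refine le_of_mul_le_mul_left ?_ hD
    have c5 := congrArg (fun t => ((1 - 2 * e₂) - q * (1 - 2 * e₁)) * t) hs
    have c6 := congrArg (fun t => ((1 - 2 * e₂) - q * (1 - 2 * e₁)) * p * t) hs'
    linarith

/-- Equality of the widths, as an identity in the chord direction `(1 - 2 * e₁, 1 - 2 * e₂)`. -/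
theorem width_identity (h : CornerPair K L H₁ H₂ κ) {m n p q r e τ₃ τ₄ e₁ e₂ : ℝ}
    (hm : 0 < m) (hn : 0 < n) (hp : 0 < p) (hq : 0 < q)
    (hmr : m ≤ r) (hnr : n ≤ r) (hpr : p ≤ r) (hqr : q ≤ r) (hr1 : r < 1)
    (hb_m : ∀ y ∈ K, y.1 - m * y.2 ≤ H₁ - m * (1 - H₂))
    (hb_n : ∀ y ∈ K, y.2 - n * y.1 ≤ H₂ - n * (1 - H₁))
    (hb_p : ∀ y ∈ L, -y.1 + p * y.2 ≤ H₁ + p * (H₂ - 1))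
    (hb_q : ∀ y ∈ L, y.2 - q * y.1 ≤ H₂ - q * (1 - H₁))
    (hmem_m : (H₁ + 2 * e₂ * -m, 1 - H₂ + 2 * e₂ * -1) ∈ K)
    (hmem_n : (1 - H₁ + 2 * e₁ * -1, H₂ + 2 * e₁ * -n) ∈ K)
    (hmem_p : ∀ t, 0 ≤ t → t ≤ τ₃ → (-H₁ + t * p, H₂ - 1 + t * 1) ∈ L)
    (hmem_q : ∀ t, 0 ≤ t → t ≤ τ₄ → (1 - H₁ + t * -1, H₂ + t * -q) ∈ L)
    (he0 : 0 < e) (heκ : 2 * e ≤ κ) (her : 2 * e < 1 - r)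
    (hτ₃ : 0 < τ₃) (hτ₄ : 0 < τ₄) (he3 : 2 * e ≤ τ₃ * (1 - r)) (he4 : 2 * e ≤ τ₄ * (1 - r))
    (h1 : r * e ≤ e₁) (h1' : e₁ ≤ e) (h2 : r * e ≤ e₂) (h2' : e₂ ≤ e) :
    (1 - p * q) * (m * e₂ * (1 - 2 * e₂) + n * e₁ * (1 - 2 * e₁)) =
      p * (e₂ - q * e₁) * (1 - 2 * e₂) + q * (e₁ - p * e₂) * (1 - 2 * e₁) := by
  have hr0 : 0 < r := hm.trans_le hmr
  have hpq : p * q ≤ r := by nlinarith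
  have hD : 0 < 1 - p * q := by linarith
  have hre : 0 < r * e := mul_pos hr0 he0
  have hμe : ∀ μ e' : ℝ, 0 < μ → μ ≤ r → 0 < e' → e' ≤ e → 0 < μ * e' ∧ μ * e' ≤ r * e :=
    fun μ e' h1 h2 h3 h4 => ⟨mul_pos h1 h3, mul_le_mul h2 h4 h3.le hr0.le⟩
  have hμx : ∀ μ e' : ℝ, 0 < μ → μ ≤ r → 0 < e' → e' ≤ e → μ * (1 - 2 * e') ≤ r := by
    intro μ e' h1 h2 h3 h4
    nlinarith [mul_pos h1 h3]
  have hm2 := hμe m e₂ hm hmr (by linarith) h2'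
  have hn2 := hμe n e₁ hn hnr (by linarith) h1'
  have hp2 := hμe p e₂ hp hpr (by linarith) h2'
  have hq2 := hμe q e₁ hq hqr (by linarith) h1'
  have hm3 := hμx m e₂ hm hmr (by linarith) h2'
  have hn3 := hμx n e₁ hn hnr (by linarith) h1'
  have hp3 := hμx p e₂ hp hpr (by linarith) h2'
  have hq3 := hμx q e₁ hq hqr (by linarith) h1'
  obtain ⟨s, hs⟩ : ∃ s, s * (1 - p * q) = 2 * (e₁ - p * e₂) :=
    ⟨2 * (e₁ - p * e₂) / (1 - p * q), div_mul_cancel₀ _ hD.ne'⟩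
  obtain ⟨s', hs'⟩ : ∃ s', s' * (1 - p * q) = 2 * (e₂ - q * e₁) :=
    ⟨2 * (e₂ - q * e₁) / (1 - p * q), div_mul_cancel₀ _ hD.ne'⟩
  have hss : 2 * e₁ - s = s' * p := by
    apply mul_right_cancel₀ hD.ne'; linear_combination -hs - p * hs'
  have hss' : 2 * e₂ - s * q = s' := by
    apply mul_right_cancel₀ hD.ne'; linear_combination -q * hs - hs'
  have hs0 : 0 ≤ s := by
    by_contra! hc; linarith [mul_neg_of_neg_of_pos hc hD]
  have hs0' : 0 ≤ s' := by
    by_contra! hc; linarith [mul_neg_of_neg_of_pos hc hD]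
  have hsτ : s ≤ τ₄ := by
    by_contra! hc
    linarith [mul_lt_mul_of_pos_right hc hD,
      mul_le_mul_of_nonneg_left (show 1 - r ≤ 1 - p * q by linarith) hτ₄.le]
  have hsτ' : s' ≤ τ₃ := by
    by_contra! hc
    linarith [mul_lt_mul_of_pos_right hc hD,
      mul_le_mul_of_nonneg_left (show 1 - r ≤ 1 - p * q by linarith) hτ₃.le]
  have hw := h.homo.width _ _ _ _ _
    (h.isExt_K hb_m hb_n hmem_m hmem_n (by linarith) (by linarith) (by linarith) (by linarith)
      (by linarith) (by linarith) (by linarith) (by linarith))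
    (h.isExt_L hb_p hb_q (hmem_p s' hs0' hsτ') (hmem_q s hs0 hsτ) hD hss hss'
      (by linarith) (by linarith) (by linarith) (by linarith) (by linarith) (by linarith)
      (by linarith) (by linarith))
  simp only [cross] at hw
  linear_combination (-(1 - p * q) / 2) * hw -
    (((1 - 2 * e₂) - q * (1 - 2 * e₁)) / 2) * hs

theorem false (h : CornerPair K L H₁ H₂ κ) : False := by
  have hκ := h.pos
  have hKc := h.homo.convexK
  have hLc := h.homo.symm.convexK
  obtain ⟨m, hm, τ₁, hτ₁, ⟨m1, m2⟩, em1, em2, hmem_m, hb_m⟩ :=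
    exists_edge h.homo.polyK (a₁ := 1) (a₂ := 0) (b₁ := 0) (b₂ := 1) h.memK₁
      (fun y hy => by linarith [(h.boxK y hy).2.1])
      (fun y hy hy' => by linarith [h.rightK y hy (by linarith)])
      ⟨_, h.memK₆, by
        have := h.boxK _ h.memK₅
        simp only at this ⊢; linarith [this.2.2.2, (h.boxK _ h.memK₁).2.2.1]⟩
  obtain ⟨n, hn, τ₂, hτ₂, ⟨n1, n2⟩, en1, en2, hmem_n, hb_n⟩ :=
    exists_edge h.homo.polyK (a₁ := 0) (a₂ := 1) (b₁ := 1) (b₂ := 0) h.memK₂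
      (fun y hy => by linarith [(h.boxK y hy).2.2.2])
      (fun y hy hy' => by linarith [h.topK y hy (by linarith)])
      ⟨_, h.memK₅, by simp only; linarith⟩
  obtain ⟨p, hp, τ₃, hτ₃, ⟨p1, p2⟩, ep1, ep2, hmem_p, hb_p⟩ :=
    exists_edge h.homo.polyL (a₁ := -1) (a₂ := 0) (b₁ := 0) (b₂ := -1) h.memL₃
      (fun y hy => by linarith [(h.boxL y hy).1])
      (fun y hy hy' => by linarith [h.leftL y hy (by linarith)])
      ⟨_, h.memL₄, by simp only; linarith⟩
  obtain ⟨q, hq, τ₄, hτ₄, ⟨q1, q2⟩, eq1, eq2, hmem_q, hb_q⟩ :=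
    exists_edge h.homo.polyL (a₁ := 0) (a₂ := 1) (b₁ := 1) (b₂ := 0) h.memL₄
      (fun y hy => by linarith [(h.boxL y hy).2.2.2])
      (fun y hy hy' => by linarith [h.topL y hy (by linarith)])
      ⟨_, h.memL₃, by simp only; linarith⟩
  simp only [zero_mul, one_mul, add_zero, zero_add, neg_mul] at em1 em2 en1 en2 ep1 ep2 eq1 eq2
  obtain rfl : m1 = -m := em1
  obtain rfl : m2 = -1 := em2
  obtain rfl : n2 = -n := en1
  obtain rfl : n1 = -1 := en2
  obtain rfl : p1 = p := by linarith
  obtain rfl : p2 = 1 := by linarith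
  obtain rfl : q2 = -q := eq1
  obtain rfl : q1 = -1 := eq2
  have hm1 : m < 1 := by
    have := hb_m _ h.memK₆; simp only at this; linarith
  have hn1 : n < 1 := by
    have := hb_n _ h.memK₅; simp only at this; linarith
  have hp1 : p1 < 1 := by
    refine lt_of_le_of_ne (by have := hb_p _ h.memL₄; simp only at this; linarith) ?_
    rintro rfl
    refine h.not_diagonal fun y hy => ?_
    have := hb_p _ hy
    linarith
  have hq1 : q < 1 := by
    refine lt_of_le_of_ne (by have := hb_q _ h.memL₃; simp only at this; linarith) ?_
    rintro rfl
    refine h.not_diagonal fun y hy => ?_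
    have := hb_q _ hy
    linarith
  obtain ⟨r, hr1, hmr, hnr, hpr, hqr⟩ : ∃ r < 1, m ≤ r ∧ n ≤ r ∧ p1 ≤ r ∧ q ≤ r :=
    ⟨max (max m n) (max p1 q), by simp [hm1, hn1, hp1, hq1], by simp, by simp, by simp, by simp⟩
  have hr0 : 0 < r := hm.trans_le hmr
  obtain ⟨e, he0, heκ, her, he1, he2, he3, he4⟩ : ∃ e > 0, 2 * e ≤ κ ∧ 2 * e < 1 - r ∧
      2 * e ≤ τ₁ ∧ 2 * e ≤ τ₂ ∧ 2 * e ≤ τ₃ * (1 - r) ∧ 2 * e ≤ τ₄ * (1 - r) := by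
    have h3 : 0 < τ₃ * (1 - r) := mul_pos hτ₃ (by linarith)
    have h4 : 0 < τ₄ * (1 - r) := mul_pos hτ₄ (by linarith)
    have hev : ∀ c : ℝ, 0 < c → ∀ᶠ e in nhdsWithin (0 : ℝ) (Set.Ioi 0), 2 * e < c := by
      intro c hc
      filter_upwards [Ioo_mem_nhdsGT (half_pos hc)] with e he
      linarith [he.2]
    obtain ⟨e, h0, h1, h2, h3, h4, h5, h6⟩ := ((eventually_mem_nhdsWithin).and
      ((hev κ hκ).and ((hev (1 - r) (by linarith)).and ((hev τ₁ hτ₁).and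
        ((hev τ₂ hτ₂).and ((hev _ h3).and (hev _ h4))))))).exists
    exact ⟨e, h0, h1.le, h2, h3.le, h4.le, h5.le, h6.le⟩
  have key : ∀ e₁ e₂ : ℝ, r * e ≤ e₁ → e₁ ≤ e → r * e ≤ e₂ → e₂ ≤ e →
      (1 - p1 * q) * (m * e₂ * (1 - 2 * e₂) + n * e₁ * (1 - 2 * e₁)) =
        p1 * (e₂ - q * e₁) * (1 - 2 * e₂) + q * (e₁ - p1 * e₂) * (1 - 2 * e₁) := by
    intro e₁ e₂ h1 h1' h2 h2'
    have hre : 0 < r * e := mul_pos hr0 he0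
    refine h.width_identity hm hn hp hq hmr hnr hpr hqr hr1 ?_ ?_ ?_ ?_
      (hmem_m _ (by linarith) (by linarith)) (hmem_n _ (by linarith) (by linarith))
      hmem_p hmem_q he0 heκ her hτ₃ hτ₄ he3 he4 h1 h1' h2 h2'
    · intro y hy; have := hb_m y hy; simp only at this; linarith
    · intro y hy; have := hb_n y hy; simp only at this; linarith
    · intro y hy; have := hb_p y hy; simp only at this; linarith
    · intro y hy; have := hb_q y hy; simp only at this; linarith
  have k1 := key e e (by nlinarith) le_rfl (by nlinarith) le_rfl
  have k2 := key e (r * e) (by nlinarith) le_rfl le_rfl (by nlinarith)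
  have k3 := key (r * e) e le_rfl (by nlinarith) (by nlinarith) le_rfl
  have k4 := key (r * e) (r * e) le_rfl (by nlinarith) le_rfl (by nlinarith)
  have : 4 * (p1 * q) * (e - r * e) ^ 2 = 0 := by linear_combination -k1 + k2 + k3 - k4
  have h5 : 0 < e - r * e := by nlinarith
  have h6 : 0 < p1 * q := mul_pos hp hq
  have : 0 < 4 * (p1 * q) * (e - r * e) ^ 2 := by positivity
  linarith

end CornerPair

/-- The set `K` is inscribed in the box with half-lengths `H₁` and `H₂`; the last four parameters
locate, up to sign, one end of its faces on the right, left, upper and lower side of the box, and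
the faces on opposite sides overlap. -/
structure CornerBox (K : Set (ℝ × ℝ)) (H₁ H₂ y y' x x' : ℝ) : Prop where
  box : ∀ z ∈ K, -H₁ ≤ z.1 ∧ z.1 ≤ H₁ ∧ -H₂ ≤ z.2 ∧ z.2 ≤ H₂
  right : ∀ z ∈ K, z.1 = H₁ → y ≤ z.2
  left : ∀ z ∈ K, z.1 = -H₁ → z.2 ≤ -y'
  top : ∀ z ∈ K, z.2 = H₂ → x ≤ z.1
  bot : ∀ z ∈ K, z.2 = -H₂ → z.1 ≤ -x'
  mem_right : (H₁, y) ∈ K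
  mem_right' : (H₁, max y y') ∈ K
  mem_left : (-H₁, -y') ∈ K
  mem_left' : (-H₁, -max y y') ∈ K
  mem_top : (x, H₂) ∈ K
  mem_top' : (max x x', H₂) ∈ K
  mem_bot : (-x', -H₂) ∈ K
  mem_bot' : (-max x x', -H₂) ∈ K

theorem mem_image_planeMap_of_eq {p q r s a b : ℝ} {K : Set (ℝ × ℝ)} {y z : ℝ × ℝ} (hz : z ∈ K)
    (h1 : y.1 = p * z.1 + q * z.2 + a) (h2 : y.2 = r * z.1 + s * z.2 + b) :
    y ∈ planeMap p q r s a b '' K :=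
  ⟨z, hz, Prod.ext h1.symm h2.symm⟩

namespace CornerBox

variable {K L : Set (ℝ × ℝ)} {H₁ H₂ y y' x x' : ℝ}

theorem neg (h : CornerBox K H₁ H₂ y y' x x') :
    CornerBox (planeMap (-1) 0 0 (-1) 0 0 '' K) H₁ H₂ y' y x' x where
  box := by
    rintro _ ⟨z, hz, rfl⟩
    have := h.box z hz
    simp only [planeMap_apply]
    refine ⟨?_, ?_, ?_, ?_⟩ <;> linarith [this.1, this.2.1, this.2.2.1, this.2.2.2]
  right := by
    rintro _ ⟨z, hz, rfl⟩ hz'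
    simp only [planeMap_apply] at hz' ⊢
    linarith [h.left z hz (by linarith)]
  left := by
    rintro _ ⟨z, hz, rfl⟩ hz'
    simp only [planeMap_apply] at hz' ⊢
    linarith [h.right z hz (by linarith)]
  top := by
    rintro _ ⟨z, hz, rfl⟩ hz'
    simp only [planeMap_apply] at hz' ⊢
    linarith [h.bot z hz (by linarith)]
  bot := by
    rintro _ ⟨z, hz, rfl⟩ hz'
    simp only [planeMap_apply] at hz' ⊢
    linarith [h.top z hz (by linarith)]
  mem_right := mem_image_planeMap_of_eq h.mem_left (by simp) (by simp)
  mem_right' := mem_image_planeMap_of_eq h.mem_left' (by simp) (by simp [max_comm])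
  mem_left := mem_image_planeMap_of_eq h.mem_right (by simp) (by simp)
  mem_left' := mem_image_planeMap_of_eq h.mem_right' (by simp) (by simp [max_comm])
  mem_top := mem_image_planeMap_of_eq h.mem_bot (by simp) (by simp)
  mem_top' := mem_image_planeMap_of_eq h.mem_bot' (by simp [max_comm]) (by simp)
  mem_bot := mem_image_planeMap_of_eq h.mem_top (by simp) (by simp)
  mem_bot' := mem_image_planeMap_of_eq h.mem_top' (by simp [max_comm]) (by simp)

theorem scale (h : CornerBox K H₁ H₂ y y' x x') {a b : ℝ} (ha : 0 < a) (hb : 0 < b) :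
    CornerBox (planeMap a 0 0 b 0 0 '' K) (a * H₁) (b * H₂) (b * y) (b * y') (a * x)
      (a * x') where
  box := by
    rintro _ ⟨z, hz, rfl⟩
    have := h.box z hz
    simp only [planeMap_apply]
    refine ⟨?_, ?_, ?_, ?_⟩ <;> nlinarith [this.1, this.2.1, this.2.2.1, this.2.2.2]
  right := by
    rintro _ ⟨z, hz, rfl⟩ hz'
    simp only [planeMap_apply] at hz' ⊢
    have := h.right z hz (mul_left_cancel₀ ha.ne' (by linarith))
    nlinarith
  left := by
    rintro _ ⟨z, hz, rfl⟩ hz'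
    simp only [planeMap_apply] at hz' ⊢
    have := h.left z hz (mul_left_cancel₀ ha.ne' (by linarith))
    nlinarith
  top := by
    rintro _ ⟨z, hz, rfl⟩ hz'
    simp only [planeMap_apply] at hz' ⊢
    have := h.top z hz (mul_left_cancel₀ hb.ne' (by linarith))
    nlinarith
  bot := by
    rintro _ ⟨z, hz, rfl⟩ hz'
    simp only [planeMap_apply] at hz' ⊢
    have := h.bot z hz (mul_left_cancel₀ hb.ne' (by linarith))
    nlinarith
  mem_right := mem_image_planeMap_of_eq h.mem_right (by simp) (by simp)
  mem_right' := mem_image_planeMap_of_eq h.mem_right' (by simp)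
    (by simp [mul_max_of_nonneg _ _ hb.le])
  mem_left := mem_image_planeMap_of_eq h.mem_left (by simp) (by simp)
  mem_left' := mem_image_planeMap_of_eq h.mem_left' (by simp)
    (by simp [mul_max_of_nonneg _ _ hb.le])
  mem_top := mem_image_planeMap_of_eq h.mem_top (by simp) (by simp)
  mem_top' := mem_image_planeMap_of_eq h.mem_top' (by simp [mul_max_of_nonneg _ _ ha.le])
    (by simp)
  mem_bot := mem_image_planeMap_of_eq h.mem_bot (by simp) (by simp)
  mem_bot' := mem_image_planeMap_of_eq h.mem_bot' (by simp [mul_max_of_nonneg _ _ ha.le])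
    (by simp)

theorem cornerPair (hKL : Homometric K L) (hK : CornerBox K H₁ H₂ y y' x x')
    (hL : CornerBox L H₁ H₂ y' y x x') (hy : y' < y) (hx : x' < x) (hx1 : H₁ + x = 1)
    (hy1 : H₂ + y = 1) : CornerPair K L H₁ H₂ (min (y - y') (x - x')) := by
  obtain rfl : y = 1 - H₂ := by linarith
  obtain rfl : x = 1 - H₁ := by linarith
  have hKc := hKL.convexK
  have hLc := hKL.symm.convexK
  set κ := min (1 - H₂ - y') (1 - H₁ - x') with hκ
  have hκ0 : 0 < κ := lt_min (by linarith) (by linarith)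
  have hκ1 : κ ≤ 1 - H₂ - y' := min_le_left _ _
  have hκ2 : κ ≤ 1 - H₁ - x' := min_le_right _ _
  obtain ⟨kb, kr, kl, kt, kd, k1, k2, k3, k4, k5, k6, k7, k8⟩ := hK
  obtain ⟨lb, lr, ll, lt, ld, l1, l2, l3, l4, l5, l6, l7, l8⟩ := hL
  rw [max_eq_left hy.le, neg_sub] at k4
  rw [max_eq_left hx.le, neg_sub] at k8 l8
  rw [max_eq_right hy.le] at l2
  rw [neg_sub] at l3
  exact
  { homo := hKL
    pos := hκ0
    boxK := kb
    boxL := lb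
    rightK := kr
    topK := kt
    leftL := fun z hz hz' => by linarith [ll z hz hz']
    topL := lt
    memK₁ := k1
    memK₂ := k5
    memK₃ := k4
    memK₄ := k8
    memK₅ := mem_of_mem_vertical hKc k4 k3 (by linarith) (by linarith)
    memK₆ := mem_of_mem_horizontal hKc k8 k7 (by linarith) (by linarith)
    memL₁ := l2
    memL₂ := mem_of_mem_vertical hLc l1 l2 (by linarith) (by linarith)
    memL₃ := l3
    memL₄ := l5
    memL₅ := l8
    memL₆ := mem_of_mem_horizontal hLc l8 l7 (by linarith) (by linarith) }

theorem false_of_lt (hKL : Homometric K L) (hK : CornerBox K H₁ H₂ y y' x x')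
    (hL : CornerBox L H₁ H₂ y' y x x') (hy : y' < y) (hx : x' < x) : False := by
  have h1 : 0 < H₁ + x := by
    have := (hK.box _ hK.mem_bot).2.1
    simp only at this
    linarith
  have h2 : 0 < H₂ + y := by
    have := (hK.box _ hK.mem_left).2.2.2
    simp only at this
    linarith
  have ha : 0 < (H₁ + x)⁻¹ := inv_pos.2 h1
  have hb : 0 < (H₂ + y)⁻¹ := inv_pos.2 h2
  have hdet : (H₁ + x)⁻¹ * (H₂ + y)⁻¹ - 0 * 0 ≠ 0 := by
    rw [mul_zero, sub_zero]; exact (mul_pos ha hb).ne'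
  exact (cornerPair (hKL.image_planeMap hdet 0 0 0 0) (hK.scale ha hb) (hL.scale ha hb)
    (mul_lt_mul_of_pos_left hy hb) (mul_lt_mul_of_pos_left hx ha)
    (by rw [← mul_add]; exact inv_mul_cancel₀ h1.ne')
    (by rw [← mul_add]; exact inv_mul_cancel₀ h2.ne')).false

theorem eq_or_eq (hKL : Homometric K L) (hK : CornerBox K H₁ H₂ y y' x x')
    (hL : CornerBox L H₁ H₂ y' y x x') : y = y' ∨ x = x' := by
  by_contra! hcon
  have hdet : (-1 : ℝ) * (-1) - 0 * 0 ≠ 0 := by norm_num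
  have hn := hKL.image_planeMap hdet 0 0 0 0
  rcases hcon.1.lt_or_gt with hy | hy <;> rcases hcon.2.lt_or_gt with hx | hx
  · exact false_of_lt hn hK.neg hL.neg hy hx
  · exact false_of_lt hKL.symm hL hK hy hx
  · exact false_of_lt hn.symm hL.neg hK.neg hy hx
  · exact false_of_lt hKL hK hL hy hx

end CornerBox

/-- The component of a plane vector in the direction of angle `θ`. -/
noncomputable def dirComp (θ : ℝ) : ℝ × ℝ →ₗ[ℝ] ℝ :=
  Real.cos θ • LinearMap.fst ℝ ℝ ℝ + Real.sin θ • LinearMap.snd ℝ ℝ ℝ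

/-- The component of a plane vector in the direction of angle `θ + π / 2`. -/
noncomputable def orthComp (θ : ℝ) : ℝ × ℝ →ₗ[ℝ] ℝ :=
  -Real.sin θ • LinearMap.fst ℝ ℝ ℝ + Real.cos θ • LinearMap.snd ℝ ℝ ℝ

theorem dirComp_apply (θ : ℝ) (z : ℝ × ℝ) :
    dirComp θ z = Real.cos θ * z.1 + Real.sin θ * z.2 := rfl

theorem orthComp_apply (θ : ℝ) (z : ℝ × ℝ) :
    orthComp θ z = -Real.sin θ * z.1 + Real.cos θ * z.2 := rfl

theorem dirComp_add_angle (θ t : ℝ) (z : ℝ × ℝ) :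
    dirComp (θ + t) z = Real.cos t * dirComp θ z + Real.sin t * orthComp θ z := by
  rw [dirComp_apply, dirComp_apply, orthComp_apply, Real.cos_add, Real.sin_add]; ring

theorem dirComp_add_pi (θ : ℝ) (z : ℝ × ℝ) : dirComp (θ + Real.pi) z = -dirComp θ z := by
  rw [dirComp_add_angle]; simp

theorem orthComp_add_pi (θ : ℝ) (z : ℝ × ℝ) : orthComp (θ + Real.pi) z = -orthComp θ z := by
  rw [orthComp_apply, orthComp_apply]; simp; ring

theorem eq_zero_of_dirComp_orthComp {θ : ℝ} {z : ℝ × ℝ} (h1 : dirComp θ z = 0)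
    (h2 : orthComp θ z = 0) : z = 0 := by
  rw [dirComp_apply] at h1
  rw [orthComp_apply] at h2
  have h := Real.sin_sq_add_cos_sq θ
  ext
  · simp only [Prod.fst_zero]
    linear_combination Real.cos θ * h1 - Real.sin θ * h2 - z.1 * h
  · simp only [Prod.snd_zero]
    linear_combination Real.sin θ * h1 + Real.cos θ * h2 - z.2 * h

/-- The support function of a planar set. -/
noncomputable def supp (K : Set (ℝ × ℝ)) (θ : ℝ) : ℝ := sSup (dirComp θ '' K)

theorem supp_eq {K : Set (ℝ × ℝ)} {θ : ℝ} {R : ℝ × ℝ} (hR : R ∈ K)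
    (h : ∀ y ∈ K, dirComp θ y ≤ dirComp θ R) : supp K θ = dirComp θ R :=
  IsGreatest.csSup_eq ⟨Set.mem_image_of_mem _ hR, by rintro _ ⟨y, hy, rfl⟩; exact h y hy⟩

/-- The point `R` maximizes over `K` the component in all directions close to `θ`
on the side given by the sign `σ`. -/
def IsVert (K : Set (ℝ × ℝ)) (σ θ : ℝ) (R : ℝ × ℝ) : Prop :=
  R ∈ K ∧ ∀ᶠ t in 𝓝[≥] (0 : ℝ), ∀ y ∈ K, dirComp (θ + σ * t) y ≤ dirComp (θ + σ * t) R

section IsVert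

variable {K : Set (ℝ × ℝ)} {σ θ : ℝ} {R : ℝ × ℝ}

theorem dirComp_add_sign_mul (hσ : σ = 1 ∨ σ = -1) (θ t : ℝ) (z : ℝ × ℝ) :
    dirComp (θ + σ * t) z =
      Real.cos t * dirComp θ z + Real.sin t * (σ * orthComp θ z) := by
  rw [dirComp_add_angle]
  rcases hσ with rfl | rfl <;> simp

theorem eventually_sin_nonneg : ∀ᶠ t in 𝓝[≥] (0 : ℝ), 0 ≤ Real.sin t := by
  filter_upwards [Icc_mem_nhdsGE Real.pi_pos] with t ht
  exact Real.sin_nonneg_of_mem_Icc ht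

theorem eventually_sin_pos : ∀ᶠ t in 𝓝[>] (0 : ℝ), 0 < Real.sin t := by
  filter_upwards [Ioo_mem_nhdsGT Real.pi_pos] with t ht
  exact Real.sin_pos_of_mem_Ioo ht

theorem exists_isVert (hK : ∃ V : Set (ℝ × ℝ), V.Finite ∧ K = convexHull ℝ V)
    (hne : K.Nonempty) (hσ : σ = 1 ∨ σ = -1) (θ : ℝ) : ∃ R, IsVert K σ θ R := by
  obtain ⟨V, hV, rfl⟩ := hK
  rw [convexHull_nonempty_iff] at hne
  obtain ⟨M, hM, hMmax⟩ := Set.exists_max_image V (dirComp θ) hV hne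
  obtain ⟨R, ⟨hR, hRM⟩, hRmax⟩ := Set.exists_max_image {v ∈ V | dirComp θ v = dirComp θ M}
    (fun v => σ * orthComp θ v) (hV.subset (Set.sep_subset V _)) ⟨M, hM, rfl⟩
  refine ⟨R, subset_convexHull ℝ V hR, ?_⟩
  have key : ∀ v ∈ V, ∀ᶠ t in 𝓝[≥] (0 : ℝ),
      dirComp (θ + σ * t) v ≤ dirComp (θ + σ * t) R := by
    intro v hv
    rcases (hMmax v hv).lt_or_eq with hlt | heq
    · have hc : ∀ z, Tendsto (fun t : ℝ => dirComp (θ + σ * t) z) (𝓝[≥] 0)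
          (𝓝 (dirComp θ z)) := by
        intro z
        have : Continuous (fun t : ℝ => dirComp (θ + σ * t) z) := by
          simp only [dirComp_apply]; fun_prop
        simpa using (this.tendsto 0).mono_left nhdsWithin_le_nhds
      rw [← hRM] at hlt
      exact ((hc v).eventually_lt (hc R) hlt).mono fun t ht => ht.le
    · filter_upwards [eventually_sin_nonneg] with t ht
      rw [dirComp_add_sign_mul hσ, dirComp_add_sign_mul hσ, heq, hRM]
      exact add_le_add_right (mul_le_mul_of_nonneg_left (hRmax v ⟨hv, heq⟩) ht) _
  have := (eventually_all_finite hV).2 key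
  filter_upwards [this] with t ht
  exact convexHull_le_of_forall ht

theorem IsVert.dirComp_le (h : IsVert K σ θ R) {y : ℝ × ℝ} (hy : y ∈ K) :
    dirComp θ y ≤ dirComp θ R := by
  have := h.2.self_of_nhdsWithin (Set.self_mem_Ici) y hy
  simpa using this

theorem IsVert.orthComp_le (hσ : σ = 1 ∨ σ = -1) (h : IsVert K σ θ R) {y : ℝ × ℝ} (hy : y ∈ K)
    (hyR : dirComp θ y = dirComp θ R) : σ * orthComp θ y ≤ σ * orthComp θ R := by
  have h1 : ∀ᶠ t in 𝓝[>] (0 : ℝ), ∀ y ∈ K, dirComp (θ + σ * t) y ≤ dirComp (θ + σ * t) R :=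
    h.2.filter_mono (nhdsWithin_mono _ Set.Ioi_subset_Ici_self)
  obtain ⟨t, ht1, ht2⟩ := (h1.and eventually_sin_pos).exists
  have := ht1 y hy
  rw [dirComp_add_sign_mul hσ, dirComp_add_sign_mul hσ, hyR] at this
  exact le_of_mul_le_mul_left (by linarith) ht2

theorem IsVert.eventually_supp_eq (h : IsVert K σ θ R) :
    ∀ᶠ t in 𝓝[≥] (0 : ℝ), supp K (θ + σ * t) = dirComp (θ + σ * t) R :=
  h.2.mono fun _ ht => supp_eq h.1 ht

theorem eq_of_eventually_dirComp_eq (hσ : σ = 1 ∨ σ = -1) {p q : ℝ × ℝ}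
    (h : ∀ᶠ t in 𝓝[>] (0 : ℝ), dirComp (θ + σ * t) p = dirComp (θ + σ * t) q) : p = q := by
  have hc : ∀ z, Tendsto (fun t : ℝ => dirComp (θ + σ * t) z) (𝓝[>] 0) (𝓝 (dirComp θ z)) := by
    intro z
    have : Continuous (fun t : ℝ => dirComp (θ + σ * t) z) := by
      simp only [dirComp_apply]; fun_prop
    simpa using (this.tendsto 0).mono_left nhdsWithin_le_nhds
  have h0 : dirComp θ p = dirComp θ q := tendsto_nhds_unique_of_eventuallyEq (hc p) (hc q) h
  obtain ⟨t, ht1, ht2⟩ := (h.and eventually_sin_pos).exists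
  rw [dirComp_add_sign_mul hσ, dirComp_add_sign_mul hσ, h0] at ht1
  have h1 : σ * orthComp θ p = σ * orthComp θ q := by
    apply mul_left_cancel₀ ht2.ne'; linarith
  have h2 : orthComp θ p = orthComp θ q := by
    rcases hσ with rfl | rfl <;> linarith
  rw [← sub_eq_zero]
  apply eq_zero_of_dirComp_orthComp (θ := θ) <;> rw [map_sub] <;> linarith

end IsVert

/-- Near `θ`, the function `f` is the support function of a point. -/
def IsLocallyDir (f : ℝ → ℝ) (θ : ℝ) : Prop :=
  ∃ p, ∀ᶠ θ' in 𝓝 θ, f θ' = dirComp θ' p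

theorem isOpen_isLocallyDir (f : ℝ → ℝ) : IsOpen {θ | IsLocallyDir f θ} := by
  rw [isOpen_iff_eventually]
  rintro θ ⟨p, hp⟩
  exact hp.eventually_nhds.mono fun θ' h => ⟨p, h⟩

theorem tendsto_add_sign_mul (σ θ : ℝ) :
    Tendsto (fun t : ℝ => θ + σ * t) (𝓝[≥] 0) (𝓝 θ) := by
  have : Continuous (fun t : ℝ => θ + σ * t) := by fun_prop
  simpa using (this.tendsto 0).mono_left nhdsWithin_le_nhds

theorem eventually_right_left {P : ℝ → Prop} {θ : ℝ}
    (h1 : ∀ᶠ t in 𝓝[≥] (0 : ℝ), P (θ + 1 * t)) (h2 : ∀ᶠ t in 𝓝[≥] (0 : ℝ), P (θ + -1 * t)) :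
    ∀ᶠ θ' in 𝓝 θ, P θ' := by
  rw [← nhdsLE_sup_nhdsGE, eventually_sup]
  constructor
  · have : Tendsto (fun θ' : ℝ => θ - θ') (𝓝[≤] θ) (𝓝[≥] 0) := by
      refine tendsto_nhdsWithin_iff.2 ⟨?_, ?_⟩
      · have : Continuous (fun θ' : ℝ => θ - θ') := by fun_prop
        simpa using (this.tendsto θ).mono_left nhdsWithin_le_nhds
      · filter_upwards [self_mem_nhdsWithin] with t ht
        simpa using ht
    refine (this.eventually h2).mono fun t ht => ?_
    convert ht using 1; ring
  · have : Tendsto (fun θ' : ℝ => θ' - θ) (𝓝[≥] θ) (𝓝[≥] 0) := by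
      refine tendsto_nhdsWithin_iff.2 ⟨?_, ?_⟩
      · have : Continuous (fun θ' : ℝ => θ' - θ) := by fun_prop
        simpa using (this.tendsto θ).mono_left nhdsWithin_le_nhds
      · filter_upwards [self_mem_nhdsWithin] with t ht
        simpa using ht
    refine (this.eventually h1).mono fun t ht => ?_
    convert ht using 1; ring

section support

variable {K L : Set (ℝ × ℝ)} {σ θ : ℝ} {R S : ℝ × ℝ}

theorem eventually_supp_sub (hR : IsVert K σ θ R) (hS : IsVert L σ θ S) :
    ∀ᶠ t in 𝓝[≥] (0 : ℝ),
      supp K (θ + σ * t) - supp L (θ + σ * t) = dirComp (θ + σ * t) (R - S) := by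
  filter_upwards [hR.eventually_supp_eq, hS.eventually_supp_eq] with t h1 h2
  rw [h1, h2, map_sub]

theorem sub_eq_of_eventually (hσ : σ = 1 ∨ σ = -1) (hR : IsVert K σ θ R) (hS : IsVert L σ θ S)
    {p : ℝ × ℝ}
    (h : ∀ᶠ t in 𝓝[>] (0 : ℝ),
      supp K (θ + σ * t) - supp L (θ + σ * t) = dirComp (θ + σ * t) p) : R - S = p := by
  apply eq_of_eventually_dirComp_eq (θ := θ) hσ
  filter_upwards [h, (eventually_supp_sub hR hS).filter_mono
    (nhdsWithin_mono _ Set.Ioi_subset_Ici_self)] with t h1 h2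
  rw [← h1, h2]

theorem sub_eq_of_eventually_nhds (hσ : σ = 1 ∨ σ = -1) (hR : IsVert K σ θ R)
    (hS : IsVert L σ θ S) {p : ℝ × ℝ}
    (h : ∀ᶠ θ' in 𝓝 θ, supp K θ' - supp L θ' = dirComp θ' p) : R - S = p :=
  sub_eq_of_eventually hσ hR hS (((tendsto_add_sign_mul σ θ).eventually h).filter_mono
    (nhdsWithin_mono _ Set.Ioi_subset_Ici_self))

theorem isLocallyDir_of_sub_eq {R' S' : ℝ × ℝ} (hR : IsVert K 1 θ R) (hS : IsVert L 1 θ S)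
    (hR' : IsVert K (-1) θ R') (hS' : IsVert L (-1) θ S') (h : R - S = R' - S') :
    IsLocallyDir (fun θ => supp K θ - supp L θ) θ := by
  refine ⟨R - S, eventually_right_left (eventually_supp_sub hR hS) ?_⟩
  rw [h]
  exact eventually_supp_sub hR' hS'

end support

theorem eq_of_eventually_dirComp_eq_nhds {θ : ℝ} {p q : ℝ × ℝ}
    (h : ∀ᶠ θ' in 𝓝 θ, dirComp θ' p = dirComp θ' q) : p = q :=
  eq_of_eventually_dirComp_eq (θ := θ) (Or.inl rfl)
    (((tendsto_add_sign_mul 1 θ).eventually h).filter_mono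
      (nhdsWithin_mono _ Set.Ioi_subset_Ici_self))

theorem exists_eq_dirComp_of_isPreconnected {f : ℝ → ℝ} {s : Set ℝ} (hs : IsPreconnected s)
    (h : ∀ θ ∈ s, IsLocallyDir f θ) : ∃ p, ∀ θ ∈ s, f θ = dirComp θ p := by
  rcases s.eq_empty_or_nonempty with rfl | ⟨θ₀, h0⟩
  · simp
  choose! p hp using h
  refine ⟨p θ₀, fun θ hθ => ?_⟩
  have : p θ = p θ₀ := by
    refine hs.induction₂ (fun a b => p a = p b) (fun x hx => ?_)
      (fun x y z _ _ _ h1 h2 => h1.trans h2) (fun x y _ _ h => h.symm) hθ h0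
    filter_upwards [nhdsWithin_le_nhds (hp x hx).eventually_nhds, self_mem_nhdsWithin]
      with y hy hys
    apply eq_of_eventually_dirComp_eq_nhds (θ := y)
    filter_upwards [hy, hp y hys] with z h1 h2
    rw [← h1, h2]
  rw [← this]
  exact (hp θ hθ).self_of_nhds

theorem isLocallyDir_add_pi {f : ℝ → ℝ} (hf : ∀ θ, f (θ + Real.pi) = -f θ) {θ : ℝ}
    (h : IsLocallyDir f θ) : IsLocallyDir f (θ + Real.pi) := by
  obtain ⟨p, hp⟩ := h
  refine ⟨p, ?_⟩
  have : Tendsto (fun t : ℝ => t - Real.pi) (𝓝 (θ + Real.pi)) (𝓝 θ) := by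
    have : Continuous (fun t : ℝ => t - Real.pi) := by fun_prop
    simpa using this.tendsto (θ + Real.pi)
  filter_upwards [this.eventually hp] with t ht
  have h1 := hf (t - Real.pi)
  have h2 := dirComp_add_pi (t - Real.pi) p
  rw [sub_add_cancel] at h1 h2
  rw [h1, h2, ht]

theorem isLocallyDir_of_add_pi {f : ℝ → ℝ} (hf : ∀ θ, f (θ + Real.pi) = -f θ) {θ : ℝ}
    (h : IsLocallyDir f (θ + Real.pi)) : IsLocallyDir f θ := by
  obtain ⟨p, hp⟩ := h
  refine ⟨p, ?_⟩
  have : Tendsto (fun t : ℝ => t + Real.pi) (𝓝 θ) (𝓝 (θ + Real.pi)) := by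
    have : Continuous (fun t : ℝ => t + Real.pi) := by fun_prop
    exact this.tendsto θ
  filter_upwards [this.eventually hp] with t ht
  rw [hf, dirComp_add_pi] at ht
  linarith

/-- If two open `π`-periodic sets of angles cover the line and neither is the whole line, then some
component of their intersection runs from an angle missing in the first to one missing in the
second. -/
theorem exists_alternating_interval {A B : Set ℝ} (hA : IsOpen A) (hB : IsOpen B)
    (hAp : ∀ θ, θ + Real.pi ∈ A → θ ∈ A) (hBp : ∀ θ, θ + Real.pi ∈ B → θ ∈ B)
    (hAB : ∀ θ, θ ∈ A ∨ θ ∈ B) (hA' : ∃ θ, θ ∉ A) (hB' : ∃ θ, θ ∉ B) :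
    ∃ θ₁ θ₂, θ₁ < θ₂ ∧ θ₂ < θ₁ + Real.pi ∧ θ₁ ∉ A ∧ θ₂ ∉ B ∧
      ∀ θ ∈ Set.Ioo θ₁ θ₂, θ ∈ A ∧ θ ∈ B := by
  obtain ⟨θ₀, h0⟩ := hA'
  obtain ⟨b, hb⟩ := hB'
  have hbn : ∀ n : ℕ, b + n * Real.pi ∉ B := by
    intro n
    induction n with
    | zero => simpa using hb
    | succ n ih =>
      intro h
      apply ih
      apply hBp
      convert h using 1
      push_cast; ring
  obtain ⟨n, hn⟩ := exists_nat_ge ((θ₀ - b) / Real.pi)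
  rw [div_le_iff₀ Real.pi_pos] at hn
  have hcl : IsClosed (Bᶜ ∩ Set.Ici θ₀) := hB.isClosed_compl.inter isClosed_Ici
  have hbdd : BddBelow (Bᶜ ∩ Set.Ici θ₀) := ⟨θ₀, fun x hx => hx.2⟩
  have h2 := hcl.csInf_mem ⟨b + n * Real.pi, hbn n, by simp; linarith⟩ hbdd
  set θ₂ := sInf (Bᶜ ∩ Set.Ici θ₀) with hθ₂
  have hcl' : IsClosed (Aᶜ ∩ Set.Icc θ₀ θ₂) := hA.isClosed_compl.inter isClosed_Icc
  have hbdd' : BddAbove (Aᶜ ∩ Set.Icc θ₀ θ₂) := ⟨θ₂, fun x hx => hx.2.2⟩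
  have h1 := hcl'.csSup_mem ⟨θ₀, h0, le_rfl, h2.2⟩ hbdd'
  set θ₁ := sSup (Aᶜ ∩ Set.Icc θ₀ θ₂) with hθ₁
  have hlt : θ₁ < θ₂ := by
    refine lt_of_le_of_ne h1.2.2 fun h => ?_
    rcases hAB θ₁ with h' | h'
    · exact h1.1 h'
    · exact h2.1 (h ▸ h')
  refine ⟨θ₁, θ₂, hlt, ?_, h1.1, h2.1, fun θ hθ => ⟨?_, ?_⟩⟩
  · by_contra! hc
    have h3 : θ₁ + Real.pi ∈ Aᶜ ∩ Set.Icc θ₀ θ₂ :=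
      ⟨fun h => h1.1 (hAp _ h), by linarith [h1.2.1, Real.pi_pos], hc⟩
    have := le_csSup hbdd' h3
    linarith [Real.pi_pos]
  · by_contra hc
    have := le_csSup hbdd' ⟨hc, h1.2.1.trans hθ.1.le, hθ.2.le⟩
    linarith [hθ.1]
  · by_contra hc
    have := csInf_le hbdd ⟨hc, h1.2.1.trans hθ.1.le⟩
    linarith [hθ.2]

section neg

variable {K L : Set (ℝ × ℝ)} {σ θ : ℝ} {R S : ℝ × ℝ}

theorem isVert_neg (h : IsVert L σ (θ + Real.pi) S) : IsVert (Neg.neg ⁻¹' L) σ θ (-S) := by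
  refine ⟨by simpa using h.1, h.2.mono fun t ht y hy => ?_⟩
  have := ht (-y) hy
  rw [add_right_comm, dirComp_add_pi, dirComp_add_pi] at this
  simpa using this

theorem isVert_neg_add_pi (h : IsVert L σ θ S) :
    IsVert (Neg.neg ⁻¹' L) σ (θ + Real.pi) (-S) := by
  refine ⟨by simpa using h.1, h.2.mono fun t ht y hy => ?_⟩
  have := ht (-y) hy
  rw [add_right_comm, dirComp_add_pi, dirComp_add_pi]
  simpa using this

theorem supp_add_two_pi (K : Set (ℝ × ℝ)) (θ : ℝ) :
    supp K (θ + Real.pi + Real.pi) = supp K θ := by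
  have : dirComp (θ + Real.pi + Real.pi) = dirComp θ := by
    ext <;> simp [dirComp_apply]
  rw [supp, supp, this]

theorem supp_neg (L : Set (ℝ × ℝ)) (θ : ℝ) : supp (Neg.neg ⁻¹' L) θ = supp L (θ + Real.pi) := by
  rw [supp, supp]
  congr 1
  ext r
  constructor
  · rintro ⟨y, hy, rfl⟩
    exact ⟨-y, hy, by simp [dirComp_add_pi]⟩
  · rintro ⟨y, hy, rfl⟩
    exact ⟨-y, by simpa using hy, by simp [dirComp_add_pi]⟩

theorem Homometric.exists_isVert (hKL : Homometric K L) (hσ : σ = 1 ∨ σ = -1) (θ : ℝ) :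
    ∃ R, IsVert K σ θ R :=
  _root_.exists_isVert hKL.polyK hKL.nonemptyK hσ θ

theorem Homometric.dirComp_le_supp (hKL : Homometric K L) {y : ℝ × ℝ} (hy : y ∈ K) (θ : ℝ) :
    dirComp θ y ≤ supp K θ := by
  obtain ⟨R, hR⟩ := hKL.exists_isVert (Or.inl rfl) θ
  rw [supp_eq hR.1 fun y hy => hR.dirComp_le hy]
  exact hR.dirComp_le hy

theorem Homometric.supp_add_supp_le (hKL : Homometric K L) (θ : ℝ) :
    supp K θ + supp K (θ + Real.pi) ≤ supp L θ + supp L (θ + Real.pi) := by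
  obtain ⟨R, hR⟩ := hKL.exists_isVert (Or.inl rfl) θ
  obtain ⟨B, hB⟩ := hKL.exists_isVert (Or.inl rfl) (θ + Real.pi)
  obtain ⟨y, hy, hy'⟩ := (hKL.diff (R - B)).1 ⟨R, hR.1, by simpa using hB.1⟩
  have h1 := hKL.symm.dirComp_le_supp hy θ
  have h2 := hKL.symm.dirComp_le_supp hy' (θ + Real.pi)
  rw [supp_eq hR.1 fun y hy => hR.dirComp_le hy, supp_eq hB.1 fun y hy => hB.dirComp_le hy]
  simp only [dirComp_add_pi, map_sub] at h2 ⊢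
  linarith

theorem Homometric.supp_add_supp (hKL : Homometric K L) (θ : ℝ) :
    supp K θ + supp K (θ + Real.pi) = supp L θ + supp L (θ + Real.pi) :=
  (hKL.supp_add_supp_le θ).antisymm (hKL.symm.supp_add_supp_le θ)

theorem Homometric.supp_sub_add_pi (hKL : Homometric K L) (θ : ℝ) :
    supp K (θ + Real.pi) - supp L (θ + Real.pi) = -(supp K θ - supp L θ) := by
  linarith [hKL.supp_add_supp θ]

theorem Homometric.supp_sub_neg_add_pi (hKL : Homometric K L) (θ : ℝ) :
    supp K (θ + Real.pi) - supp (Neg.neg ⁻¹' L) (θ + Real.pi) =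
      -(supp K θ - supp (Neg.neg ⁻¹' L) θ) := by
  rw [supp_neg, supp_neg, supp_add_two_pi]
  linarith [hKL.supp_add_supp θ]

theorem IsVert.orthComp_le_orthComp {A A' : ℝ × ℝ} (hA : IsVert K 1 θ A)
    (hA' : IsVert K (-1) θ A') : orthComp θ A' ≤ orthComp θ A := by
  have h : dirComp θ A' = dirComp θ A := (hA.dirComp_le hA'.1).antisymm (hA'.dirComp_le hA.1)
  simpa using hA.orthComp_le (Or.inl rfl) hA'.1 h

theorem IsVert.dirComp_eq {A A' : ℝ × ℝ} {τ : ℝ} (hA : IsVert K σ θ A)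
    (hA' : IsVert K τ θ A') : dirComp θ A = dirComp θ A' :=
  (hA'.dirComp_le hA.1).antisymm (hA.dirComp_le hA'.1)

theorem mem_face_iff (hK : Convex ℝ K) {A A' z : ℝ × ℝ} (hA : IsVert K 1 θ A)
    (hA' : IsVert K (-1) θ A') (hz : dirComp θ z = dirComp θ A) :
    z ∈ K ↔ orthComp θ A' ≤ orthComp θ z ∧ orthComp θ z ≤ orthComp θ A := by
  constructor
  · intro h
    have h1 := hA.orthComp_le (Or.inl rfl) h hz
    have h2 := hA'.orthComp_le (Or.inr rfl) h (hz.trans (hA.dirComp_eq hA'))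
    constructor <;> linarith
  · rintro ⟨h1, h2⟩
    obtain ⟨a, b, ha, hb, hab, h⟩ :=
      (segment_eq_Icc (h1.trans h2)).ge (⟨h1, h2⟩ : orthComp θ z ∈ Set.Icc _ _)
    have : z = a • A' + b • A := by
      rw [← sub_eq_zero]
      apply eq_zero_of_dirComp_orthComp (θ := θ)
      · simp only [map_sub, map_add, map_smul, smul_eq_mul, hz, ← hA.dirComp_eq hA']
        linear_combination (-dirComp θ A) * hab
      · simp only [map_sub, map_add, map_smul, smul_eq_mul] at h ⊢
        linear_combination -h
    rw [this]
    exact hK hA'.1 hA.1 ha hb hab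

theorem topFace_image (hK : Convex ℝ K) {A A' : ℝ × ℝ} (hA : IsVert K 1 θ A)
    (hA' : IsVert K (-1) θ A') :
    TopFace (planeMap (-Real.sin θ) (Real.cos θ) (Real.cos θ) (Real.sin θ) 0 0 '' K)
      (dirComp θ A) (orthComp θ A') (orthComp θ A) := by
  have hz : ∀ z, planeMap (-Real.sin θ) (Real.cos θ) (Real.cos θ) (Real.sin θ) 0 0 z =
      (orthComp θ z, dirComp θ z) := by
    intro z; simp [planeMap_apply, orthComp_apply, dirComp_apply]
  have hd : -Real.sin θ * Real.sin θ - Real.cos θ * Real.cos θ ≠ 0 := by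
    have := Real.sin_sq_add_cos_sq θ
    intro h; nlinarith
  refine ⟨hA.orthComp_le_orthComp hA', ?_, fun t => ?_⟩
  · rintro _ ⟨z, h, rfl⟩
    rw [hz]
    exact hA.dirComp_le h
  · obtain ⟨z, h⟩ := exists_planeMap_zero_eq hd (t, dirComp θ A)
    rw [← h, planeMap_mem_image hd]
    rw [hz, Prod.mk.injEq] at h
    rw [mem_face_iff hK hA hA' h.2, h.1]

theorem botFace_image (hK : Convex ℝ K) {B B' : ℝ × ℝ} (hB : IsVert K 1 (θ + Real.pi) B)
    (hB' : IsVert K (-1) (θ + Real.pi) B') :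
    BotFace (planeMap (-Real.sin θ) (Real.cos θ) (Real.cos θ) (Real.sin θ) 0 0 '' K)
      (dirComp θ B) (orthComp θ B) (orthComp θ B') := by
  have hz : ∀ z, planeMap (-Real.sin θ) (Real.cos θ) (Real.cos θ) (Real.sin θ) 0 0 z =
      (orthComp θ z, dirComp θ z) := by
    intro z; simp [planeMap_apply, orthComp_apply, dirComp_apply]
  have hd : -Real.sin θ * Real.sin θ - Real.cos θ * Real.cos θ ≠ 0 := by
    have := Real.sin_sq_add_cos_sq θ
    intro h; nlinarith
  refine ⟨?_, ?_, fun t => ?_⟩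
  · have := hB.orthComp_le_orthComp hB'
    simp only [orthComp_add_pi] at this
    linarith
  · rintro _ ⟨z, h, rfl⟩
    rw [hz]
    have := hB.dirComp_le h
    simp only [dirComp_add_pi] at this
    linarith
  · obtain ⟨z, h⟩ := exists_planeMap_zero_eq hd (t, dirComp θ B)
    rw [← h, planeMap_mem_image hd]
    rw [hz, Prod.mk.injEq] at h
    rw [mem_face_iff hK hB hB' (by rw [dirComp_add_pi, dirComp_add_pi, h.2]), ← h.1]
    simp only [orthComp_add_pi]
    constructor <;> rintro ⟨h1, h2⟩ <;> constructor <;> linarith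

theorem Homometric.isLocallyDir_or (hKL : Homometric K L) (θ : ℝ) :
    IsLocallyDir (fun θ => supp K θ - supp L θ) θ ∨
      IsLocallyDir (fun θ => supp K θ - supp (Neg.neg ⁻¹' L) θ) θ := by
  have hd : -Real.sin θ * Real.sin θ - Real.cos θ * Real.cos θ ≠ 0 := by
    have := Real.sin_sq_add_cos_sq θ
    intro h; nlinarith
  obtain ⟨A, hA⟩ := hKL.exists_isVert (Or.inl rfl) θ
  obtain ⟨A', hA'⟩ := hKL.exists_isVert (Or.inr rfl) θ
  obtain ⟨B, hB⟩ := hKL.exists_isVert (Or.inl rfl) (θ + Real.pi)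
  obtain ⟨B', hB'⟩ := hKL.exists_isVert (Or.inr rfl) (θ + Real.pi)
  obtain ⟨C, hC⟩ := hKL.symm.exists_isVert (Or.inl rfl) θ
  obtain ⟨C', hC'⟩ := hKL.symm.exists_isVert (Or.inr rfl) θ
  obtain ⟨D, hD⟩ := hKL.symm.exists_isVert (Or.inl rfl) (θ + Real.pi)
  obtain ⟨D', hD'⟩ := hKL.symm.exists_isVert (Or.inr rfl) (θ + Real.pi)
  rcases (hKL.image_planeMap hd 0 0 0 0).face_length (topFace_image hKL.convexK hA hA')
    (botFace_image hKL.convexK hB hB') (topFace_image hKL.symm.convexK hC hC')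
    (botFace_image hKL.symm.convexK hD hD') with h | h
  · left
    refine isLocallyDir_of_sub_eq hA hC hA' hC' ?_
    rw [← sub_eq_zero]
    apply eq_zero_of_dirComp_orthComp (θ := θ)
    · simp only [map_sub]
      linarith [hA.dirComp_eq hA', hC.dirComp_eq hC']
    · simp only [map_sub]
      linarith
  · right
    refine isLocallyDir_of_sub_eq hA (isVert_neg hD) hA' (isVert_neg hD') ?_
    rw [← sub_eq_zero]
    have h1 := hD.dirComp_eq hD'
    simp only [dirComp_add_pi] at h1
    apply eq_zero_of_dirComp_orthComp (θ := θ)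
    · simp only [map_sub, map_neg]
      linarith [hA.dirComp_eq hA']
    · simp only [map_sub, map_neg]
      linarith

end neg

/-- A closed convex set is contained in another one if its support function is dominated. -/
theorem subset_of_dirComp_le {K L : Set (ℝ × ℝ)} (hL : Convex ℝ L) (hLc : IsClosed L)
    (h : ∀ θ, ∀ y ∈ K, ∃ z ∈ L, dirComp θ y ≤ dirComp θ z) : K ⊆ L := by
  intro y hy
  by_contra hyL
  obtain ⟨f, u, hu, hfy⟩ := geometric_hahn_banach_closed_point hL hLc hyL
  set c : ℂ := ⟨f (1, 0), f (0, 1)⟩ with hc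
  have hf : ∀ z : ℝ × ℝ, f z = ‖c‖ * dirComp c.arg z := by
    intro z
    have h1 : z = z.1 • ((1, 0) : ℝ × ℝ) + z.2 • ((0, 1) : ℝ × ℝ) := by ext <;> simp
    have h2 := Complex.norm_mul_cos_arg c
    have h3 := Complex.norm_mul_sin_arg c
    rw [dirComp_apply, mul_add, ← mul_assoc, ← mul_assoc, h2, h3]
    conv_lhs => rw [h1]
    simp only [map_add, map_smul, smul_eq_mul, hc]
    ring
  obtain ⟨z, hz, hyz⟩ := h c.arg y hy
  have h1 := hu z hz
  rw [hf] at h1 hfy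
  have := mul_le_mul_of_nonneg_left hyz (norm_nonneg c)
  linarith

theorem sub_mem_of_supp_sub_eq {K L : Set (ℝ × ℝ)} {p : ℝ × ℝ} (hL : Convex ℝ L)
    (hLc : IsClosed L) (hK : ∀ θ, ∃ R, IsVert K 1 θ R) (hL' : ∀ θ, ∃ S, IsVert L 1 θ S)
    (h : ∀ θ, supp K θ - supp L θ = dirComp θ p) : ∀ z ∈ K, z - p ∈ L := by
  suffices hs : (fun z => z - p) '' K ⊆ L from fun z hz => hs (Set.mem_image_of_mem _ hz)
  refine subset_of_dirComp_le hL hLc ?_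
  rintro θ _ ⟨y, hy, rfl⟩
  obtain ⟨S, hS⟩ := hL' θ
  obtain ⟨R, hR⟩ := hK θ
  refine ⟨S, hS.1, ?_⟩
  have h1 := h θ
  rw [supp_eq hS.1 fun y hy => hS.dirComp_le hy, supp_eq hR.1 fun y hy => hR.dirComp_le hy] at h1
  have h2 := hR.dirComp_le hy
  simp only [map_sub]
  linarith

theorem mem_iff_of_supp_sub_eq {K L : Set (ℝ × ℝ)} {p : ℝ × ℝ} (hK : Convex ℝ K)
    (hKc : IsClosed K) (hL : Convex ℝ L) (hLc : IsClosed L) (hK' : ∀ θ, ∃ R, IsVert K 1 θ R)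
    (hL' : ∀ θ, ∃ S, IsVert L 1 θ S) (h : ∀ θ, supp K θ - supp L θ = dirComp θ p) (z : ℝ × ℝ) :
    z ∈ K ↔ z - p ∈ L := by
  refine ⟨sub_mem_of_supp_sub_eq hL hLc hK' hL' h z, fun hz => ?_⟩
  have := sub_mem_of_supp_sub_eq (p := -p) hK hKc hL' hK'
    (fun θ => by rw [map_neg, ← h θ]; ring) _ hz
  simpa using this

section alternating

variable {K L : Set (ℝ × ℝ)} {σ θ θ₁ θ₂ : ℝ}

theorem IsVert.sin_mul_nonneg {R z : ℝ × ℝ} (hσ : σ = 1 ∨ σ = -1) (h : IsVert K σ θ R)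
    (hz : z ∈ K) (hzR : dirComp θ z = dirComp θ R) (φ : ℝ) :
    0 ≤ Real.sin (φ - θ) * (σ * (dirComp φ R - dirComp φ z)) := by
  have h1 := h.orthComp_le hσ hz hzR
  have h2 := dirComp_add_angle θ (φ - θ) R
  have h3 := dirComp_add_angle θ (φ - θ) z
  rw [add_sub_cancel] at h2 h3
  rw [h2, h3, hzR]
  have h4 := mul_nonneg (sq_nonneg (Real.sin (φ - θ))) (sub_nonneg.2 h1)
  linear_combination h4

theorem cornerBox_image {A₁ A₁' B₁ B₁' A₂ A₂' B₂ B₂' v : ℝ × ℝ} (hK : Convex ℝ K)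
    (hδ : 0 < Real.sin (θ₂ - θ₁))
    (hA₁ : IsVert K 1 θ₁ A₁) (hA₁' : IsVert K (-1) θ₁ A₁')
    (hB₁ : IsVert K 1 (θ₁ + Real.pi) B₁) (hB₁' : IsVert K (-1) (θ₁ + Real.pi) B₁')
    (hA₂ : IsVert K 1 θ₂ A₂) (hA₂' : IsVert K (-1) θ₂ A₂')
    (hB₂ : IsVert K 1 (θ₂ + Real.pi) B₂) (hB₂' : IsVert K (-1) (θ₂ + Real.pi) B₂')
    (h₁ : A₁ + B₁ + (v + v) = 0) (h₂ : A₂' + B₂' + (v + v) = 0) :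
    CornerBox (planeMap (Real.cos θ₁) (Real.sin θ₁) (Real.cos θ₂) (Real.sin θ₂)
        (dirComp θ₁ v) (dirComp θ₂ v) '' K)
      (dirComp θ₁ (A₁ + v)) (dirComp θ₂ (A₂' + v)) (dirComp θ₂ (A₁' + v))
      (-dirComp θ₂ (B₁' + v)) (dirComp θ₁ (A₂ + v)) (-dirComp θ₁ (B₂ + v)) := by
  set M := planeMap (Real.cos θ₁) (Real.sin θ₁) (Real.cos θ₂) (Real.sin θ₂)
    (dirComp θ₁ v) (dirComp θ₂ v) with hM
  have hMz : ∀ z, M z = (dirComp θ₁ (z + v), dirComp θ₂ (z + v)) := by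
    intro z
    simp only [hM, planeMap_apply, map_add, dirComp_apply]
  have hsum : ∀ φ, dirComp φ A₁ + dirComp φ B₁ + (dirComp φ v + dirComp φ v) = 0 ∧
      dirComp φ A₂' + dirComp φ B₂' + (dirComp φ v + dirComp φ v) = 0 := by
    intro φ
    constructor
    · simpa using congrArg (dirComp φ) h₁
    · simpa using congrArg (dirComp φ) h₂
  have hδ1 : Real.sin (θ₂ - (θ₁ + Real.pi)) = -Real.sin (θ₂ - θ₁) := by
    rw [← sub_sub, Real.sin_sub_pi]
  have hδ2 : Real.sin (θ₁ - θ₂) = -Real.sin (θ₂ - θ₁) := by rw [← Real.sin_neg, neg_sub]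
  have hδ3 : Real.sin (θ₁ - (θ₂ + Real.pi)) = Real.sin (θ₂ - θ₁) := by
    rw [← sub_sub, Real.sin_sub_pi, hδ2, neg_neg]
  have eA₁ := hA₁.dirComp_eq hA₁'
  have eB₁ := hB₁.dirComp_eq hB₁'
  have eA₂ := hA₂.dirComp_eq hA₂'
  have eB₂ := hB₂.dirComp_eq hB₂'
  simp only [dirComp_add_pi] at eB₁ eB₂
  have fA₁ : ∀ z ∈ K, dirComp θ₁ z = dirComp θ₁ A₁ →
      dirComp θ₂ A₁' ≤ dirComp θ₂ z ∧ dirComp θ₂ z ≤ dirComp θ₂ A₁ := by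
    intro z hz hzA
    have h1 := hA₁.sin_mul_nonneg (Or.inl rfl) hz hzA θ₂
    have h2 := hA₁'.sin_mul_nonneg (Or.inr rfl) hz (hzA.trans eA₁) θ₂
    have h1 := nonneg_of_mul_nonneg_right h1 hδ
    have h2 := nonneg_of_mul_nonneg_right h2 hδ
    constructor <;> linarith
  have fB₁ : ∀ z ∈ K, dirComp θ₁ z = dirComp θ₁ B₁ →
      dirComp θ₂ B₁ ≤ dirComp θ₂ z ∧ dirComp θ₂ z ≤ dirComp θ₂ B₁' := by
    intro z hz hzA
    have h1 := hB₁.sin_mul_nonneg (Or.inl rfl) hz (by simp [dirComp_add_pi, hzA]) θ₂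
    have h2 := hB₁'.sin_mul_nonneg (Or.inr rfl) hz (by simp [dirComp_add_pi, hzA]; linarith) θ₂
    rw [hδ1, neg_mul, ← mul_neg] at h1 h2
    have h1 := nonneg_of_mul_nonneg_right h1 hδ
    have h2 := nonneg_of_mul_nonneg_right h2 hδ
    constructor <;> linarith
  have fA₂ : ∀ z ∈ K, dirComp θ₂ z = dirComp θ₂ A₂ →
      dirComp θ₁ A₂ ≤ dirComp θ₁ z ∧ dirComp θ₁ z ≤ dirComp θ₁ A₂' := by
    intro z hz hzA
    have h1 := hA₂.sin_mul_nonneg (Or.inl rfl) hz hzA θ₁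
    have h2 := hA₂'.sin_mul_nonneg (Or.inr rfl) hz (hzA.trans eA₂) θ₁
    rw [hδ2, neg_mul, ← mul_neg] at h1 h2
    have h1 := nonneg_of_mul_nonneg_right h1 hδ
    have h2 := nonneg_of_mul_nonneg_right h2 hδ
    constructor <;> linarith
  have fB₂ : ∀ z ∈ K, dirComp θ₂ z = dirComp θ₂ B₂ →
      dirComp θ₁ B₂' ≤ dirComp θ₁ z ∧ dirComp θ₁ z ≤ dirComp θ₁ B₂ := by
    intro z hz hzA
    have h1 := hB₂.sin_mul_nonneg (Or.inl rfl) hz (by simp [dirComp_add_pi, hzA]) θ₁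
    have h2 := hB₂'.sin_mul_nonneg (Or.inr rfl) hz (by simp [dirComp_add_pi, hzA]; linarith) θ₁
    rw [hδ3] at h1 h2
    have h1 := nonneg_of_mul_nonneg_right h1 hδ
    have h2 := nonneg_of_mul_nonneg_right h2 hδ
    constructor <;> linarith
  have hconv : Convex ℝ (M '' K) := hK.affine_image M
  have hs1 := hsum θ₁
  have hs2 := hsum θ₂
  have mem : ∀ z ∈ K, ∀ a b, dirComp θ₁ z + dirComp θ₁ v = a →
      dirComp θ₂ z + dirComp θ₂ v = b → (a, b) ∈ M '' K := by
    rintro z hz a b rfl rfl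
    exact ⟨z, hz, by rw [hMz]; simp only [map_add]⟩
  have f1 := fA₁ _ hA₁'.1 eA₁.symm
  have f2 := fB₁ _ hB₁'.1 (by linarith)
  have f3 := fA₂ _ hA₂'.1 eA₂.symm
  have f4 := fB₂ _ hB₂'.1 (by linarith)
  constructor
  · rintro _ ⟨z, hz, rfl⟩
    have h1 := hA₁.dirComp_le hz
    have h2 := hB₁.dirComp_le hz
    have h3 := hA₂'.dirComp_le hz
    have h4 := hB₂'.dirComp_le hz
    rw [hMz]
    simp only [dirComp_add_pi, map_add] at *
    refine ⟨?_, ?_, ?_, ?_⟩ <;> linarith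
  · rintro _ ⟨z, hz, rfl⟩ h
    rw [hMz] at h ⊢
    simp only [map_add] at *
    linarith [(fA₁ z hz (by linarith)).1]
  · rintro _ ⟨z, hz, rfl⟩ h
    rw [hMz] at h ⊢
    simp only [map_add] at *
    linarith [(fB₁ z hz (by linarith)).2]
  · rintro _ ⟨z, hz, rfl⟩ h
    rw [hMz] at h ⊢
    simp only [map_add] at *
    linarith [(fA₂ z hz (by linarith)).1]
  · rintro _ ⟨z, hz, rfl⟩ h
    rw [hMz] at h ⊢
    simp only [map_add] at *
    linarith [(fB₂ z hz (by linarith)).2]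
  · exact mem _ hA₁'.1 _ _ (by simp only [map_add]; linarith) (by simp only [map_add])
  · refine mem_of_mem_vertical hconv
      (mem _ hA₁'.1 _ (dirComp θ₂ (A₁' + v)) (by simp only [map_add]; linarith)
        (by simp only [map_add]))
      (mem _ hA₁.1 _ (dirComp θ₂ (A₁ + v)) (by simp only [map_add]) (by simp only [map_add]))
      (le_max_left _ _) (max_le ?_ ?_) <;> simp only [map_add] <;> linarith
  · exact mem _ hB₁'.1 _ _ (by simp only [map_add]; linarith) (by simp only [map_add]; linarith)
  · refine mem_of_mem_vertical hconv
      (mem _ hB₁.1 _ (dirComp θ₂ (B₁ + v)) (by simp only [map_add]; linarith)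
        (by simp only [map_add]))
      (mem _ hB₁'.1 _ (dirComp θ₂ (B₁' + v)) (by simp only [map_add]; linarith)
        (by simp only [map_add])) (le_neg.2 (max_le ?_ ?_)) (neg_le.2 (le_max_right _ _)) <;>
      simp only [map_add] <;> linarith
  · exact mem _ hA₂.1 _ _ (by simp only [map_add]) (by simp only [map_add]; linarith)
  · refine mem_of_mem_horizontal hconv
      (mem _ hA₂.1 (dirComp θ₁ (A₂ + v)) _ (by simp only [map_add])
        (by simp only [map_add]; linarith))
      (mem _ hA₂'.1 (dirComp θ₁ (A₂' + v)) _ (by simp only [map_add]) (by simp only [map_add]))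
      (le_max_left _ _) (max_le ?_ ?_) <;> simp only [map_add] <;> linarith
  · exact mem _ hB₂.1 _ _ (by simp only [map_add]; linarith) (by simp only [map_add]; linarith)
  · refine mem_of_mem_horizontal hconv
      (mem _ hB₂'.1 (dirComp θ₁ (B₂' + v)) _ (by simp only [map_add])
        (by simp only [map_add]; linarith))
      (mem _ hB₂.1 (dirComp θ₁ (B₂ + v)) _ (by simp only [map_add])
        (by simp only [map_add]; linarith)) (le_neg.2 (max_le ?_ ?_))
      (neg_le.2 (le_max_right _ _)) <;>
      simp only [map_add] <;> linarith

theorem eventually_right_eq_dirComp {f : ℝ → ℝ} {p : ℝ × ℝ} (h12 : θ₁ < θ₂)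
    (h : ∀ θ ∈ Set.Ioo θ₁ θ₂, f θ = dirComp θ p) :
    ∀ᶠ t in 𝓝[>] (0 : ℝ), f (θ₁ + 1 * t) = dirComp (θ₁ + 1 * t) p := by
  filter_upwards [Ioo_mem_nhdsGT (sub_pos.2 h12)] with t ht
  exact h _ ⟨by linarith [ht.1], by linarith [ht.2]⟩

theorem eventually_left_eq_dirComp {f : ℝ → ℝ} {p : ℝ × ℝ} (h12 : θ₁ < θ₂)
    (h : ∀ θ ∈ Set.Ioo θ₁ θ₂, f θ = dirComp θ p) :
    ∀ᶠ t in 𝓝[>] (0 : ℝ), f (θ₂ + -1 * t) = dirComp (θ₂ + -1 * t) p := by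
  filter_upwards [Ioo_mem_nhdsGT (sub_pos.2 h12)] with t ht
  exact h _ ⟨by linarith [ht.2], by linarith [ht.1]⟩

theorem eventually_eq_dirComp_add_pi {f : ℝ → ℝ} {p : ℝ × ℝ}
    (hf : ∀ θ, f (θ + Real.pi) = -f θ)
    (h : ∀ᶠ t in 𝓝[>] (0 : ℝ), f (θ + σ * t) = dirComp (θ + σ * t) p) :
    ∀ᶠ t in 𝓝[>] (0 : ℝ), f (θ + Real.pi + σ * t) = dirComp (θ + Real.pi + σ * t) p := by
  filter_upwards [h] with t ht
  rw [add_right_comm, hf, dirComp_add_pi, ht]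

theorem sub_eq_of_isLocallyDir {R S R' S' p : ℝ × ℝ} {τ : ℝ} (hσ : σ = 1 ∨ σ = -1)
    (hτ : τ = 1 ∨ τ = -1) (hR : IsVert K σ θ R) (hS : IsVert L σ θ S) (hR' : IsVert K τ θ R')
    (hS' : IsVert L τ θ S') (h : IsLocallyDir (fun θ => supp K θ - supp L θ) θ)
    (hp : R - S = p) : R' - S' = p := by
  obtain ⟨r, hr⟩ := h
  rw [← hp, sub_eq_of_eventually_nhds hσ hR hS hr, sub_eq_of_eventually_nhds hτ hR' hS' hr]

theorem eq_zero_of_dirComp_eq_zero {z : ℝ × ℝ} (hδ : Real.sin (θ₂ - θ₁) ≠ 0)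
    (h₁ : dirComp θ₁ z = 0) (h₂ : dirComp θ₂ z = 0) : z = 0 := by
  refine eq_zero_of_dirComp_orthComp h₁ ?_
  have h := dirComp_add_angle θ₁ (θ₂ - θ₁) z
  rw [add_sub_cancel, h₁, h₂, mul_zero, zero_add] at h
  exact (mul_eq_zero.1 h.symm).resolve_left hδ

end alternating

/-- Two homometric polygons cannot be translates of each other near an angle and reflected
translates near another angle, without one of these holding globally. -/
theorem Homometric.forall_isLocallyDir {K L : Set (ℝ × ℝ)} (hKL : Homometric K L) :
    (∀ θ, IsLocallyDir (fun θ => supp K θ - supp L θ) θ) ∨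
      ∀ θ, IsLocallyDir (fun θ => supp K θ - supp (Neg.neg ⁻¹' L) θ) θ := by
  by_contra! hcon
  have hf := hKL.supp_sub_add_pi
  have he := hKL.supp_sub_neg_add_pi
  obtain ⟨θ₁, θ₂, h12, h21, hn₁, hn₂, hI⟩ := exists_alternating_interval
    (isOpen_isLocallyDir fun θ => supp K θ - supp L θ)
    (isOpen_isLocallyDir fun θ => supp K θ - supp (Neg.neg ⁻¹' L) θ)
    (fun θ => isLocallyDir_of_add_pi (f := fun θ => supp K θ - supp L θ) hf)
    (fun θ => isLocallyDir_of_add_pi (f := fun θ => supp K θ - supp (Neg.neg ⁻¹' L) θ) he)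
    hKL.isLocallyDir_or hcon.1 hcon.2
  have he₁ := (hKL.isLocallyDir_or θ₁).resolve_left hn₁
  have hf₂ := (hKL.isLocallyDir_or θ₂).resolve_right hn₂
  have he₁' := isLocallyDir_add_pi (f := fun θ => supp K θ - supp (Neg.neg ⁻¹' L) θ) he he₁
  have hf₂' := isLocallyDir_add_pi (f := fun θ => supp K θ - supp L θ) hf hf₂
  obtain ⟨p, hp⟩ := exists_eq_dirComp_of_isPreconnected isPreconnected_Ioo fun θ hθ => (hI θ hθ).1
  obtain ⟨q, hq⟩ := exists_eq_dirComp_of_isPreconnected isPreconnected_Ioo fun θ hθ => (hI θ hθ).2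
  have hδ : 0 < Real.sin (θ₂ - θ₁) := Real.sin_pos_of_pos_of_lt_pi (by linarith) (by linarith)
  have o1 : (1 : ℝ) = 1 ∨ (1 : ℝ) = -1 := Or.inl rfl
  have o2 : (-1 : ℝ) = 1 ∨ (-1 : ℝ) = -1 := Or.inr rfl
  obtain ⟨A₁, hA₁⟩ := hKL.exists_isVert o1 θ₁
  obtain ⟨A₁', hA₁'⟩ := hKL.exists_isVert o2 θ₁
  obtain ⟨B₁, hB₁⟩ := hKL.exists_isVert o1 (θ₁ + Real.pi)
  obtain ⟨B₁', hB₁'⟩ := hKL.exists_isVert o2 (θ₁ + Real.pi)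
  obtain ⟨A₂, hA₂⟩ := hKL.exists_isVert o1 θ₂
  obtain ⟨A₂', hA₂'⟩ := hKL.exists_isVert o2 θ₂
  obtain ⟨B₂, hB₂⟩ := hKL.exists_isVert o1 (θ₂ + Real.pi)
  obtain ⟨B₂', hB₂'⟩ := hKL.exists_isVert o2 (θ₂ + Real.pi)
  obtain ⟨C₁, hC₁⟩ := hKL.symm.exists_isVert o1 θ₁
  obtain ⟨C₁', hC₁'⟩ := hKL.symm.exists_isVert o2 θ₁
  obtain ⟨D₁, hD₁⟩ := hKL.symm.exists_isVert o1 (θ₁ + Real.pi)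
  obtain ⟨D₁', hD₁'⟩ := hKL.symm.exists_isVert o2 (θ₁ + Real.pi)
  obtain ⟨C₂, hC₂⟩ := hKL.symm.exists_isVert o1 θ₂
  obtain ⟨C₂', hC₂'⟩ := hKL.symm.exists_isVert o2 θ₂
  obtain ⟨D₂, hD₂⟩ := hKL.symm.exists_isVert o1 (θ₂ + Real.pi)
  obtain ⟨D₂', hD₂'⟩ := hKL.symm.exists_isVert o2 (θ₂ + Real.pi)
  have pr := eventually_right_eq_dirComp h12 hp
  have pl := eventually_left_eq_dirComp h12 hp
  have qr := eventually_right_eq_dirComp h12 hq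
  have ql := eventually_left_eq_dirComp h12 hq
  have pr' := eventually_eq_dirComp_add_pi (f := fun θ => supp K θ - supp L θ) hf pr
  have pl' := eventually_eq_dirComp_add_pi (f := fun θ => supp K θ - supp L θ) hf pl
  have qr' := eventually_eq_dirComp_add_pi
    (f := fun θ => supp K θ - supp (Neg.neg ⁻¹' L) θ) he qr
  have ql' := eventually_eq_dirComp_add_pi
    (f := fun θ => supp K θ - supp (Neg.neg ⁻¹' L) θ) he ql
  have a1 : A₁ - C₁ = p := sub_eq_of_eventually o1 hA₁ hC₁ pr
  have a2 : B₁ - D₁ = p := sub_eq_of_eventually o1 hB₁ hD₁ pr'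
  have a3 : A₁ - -D₁ = q := sub_eq_of_eventually o1 hA₁ (isVert_neg hD₁) qr
  have a4 : B₁ - -C₁ = q := sub_eq_of_eventually o1 hB₁ (isVert_neg_add_pi hC₁) qr'
  have a5 : A₁' - -D₁' = q := sub_eq_of_isLocallyDir o1 o2 hA₁ (isVert_neg hD₁) hA₁'
    (isVert_neg hD₁') he₁ a3
  have a6 : B₁' - -C₁' = q := sub_eq_of_isLocallyDir o1 o2 hB₁ (isVert_neg_add_pi hC₁) hB₁'
    (isVert_neg_add_pi hC₁') he₁' a4
  have b1 : A₂' - C₂' = p := sub_eq_of_eventually o2 hA₂' hC₂' pl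
  have b2 : B₂' - D₂' = p := sub_eq_of_eventually o2 hB₂' hD₂' pl'
  have b3 : A₂' - -D₂' = q := sub_eq_of_eventually o2 hA₂' (isVert_neg hD₂') ql
  have b5 : A₂ - C₂ = p := sub_eq_of_isLocallyDir o2 o1 hA₂' hC₂' hA₂ hC₂ hf₂ b1
  have b6 : B₂ - D₂ = p := sub_eq_of_isLocallyDir o2 o1 hB₂' hD₂' hB₂ hD₂ hf₂' b2
  have n1 : A₁' - C₁' ≠ p := fun h =>
    hn₁ (isLocallyDir_of_sub_eq hA₁ hC₁ hA₁' hC₁' (a1.trans h.symm))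
  have n2 : A₂ - -D₂ ≠ q := fun h =>
    hn₂ (isLocallyDir_of_sub_eq hA₂ (isVert_neg hD₂) hA₂' (isVert_neg hD₂') (h.trans b3.symm))
  obtain ⟨v, hv⟩ : ∃ v : ℝ × ℝ, p + q + (v + v) = 0 :=
    ⟨-((1 / 2 : ℝ) • (p + q)), by module⟩
  have hcK := cornerBox_image (v := v) hKL.convexK hδ hA₁ hA₁' hB₁ hB₁' hA₂ hA₂' hB₂ hB₂'
    (by linear_combination hv + a2 + a3)
    (by linear_combination hv + b2 + b3)
  have hcL := cornerBox_image (v := v + p) hKL.symm.convexK hδ hC₁ hC₁' hD₁ hD₁' hC₂ hC₂' hD₂ hD₂'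
    (by linear_combination hv + a3 - a1)
    (by linear_combination hv + b3 - b1)
  have e1 : C₁ + (v + p) = A₁ + v := by linear_combination -a1
  have e2 : C₂' + (v + p) = A₂' + v := by linear_combination -b1
  have e3 : C₁' + (v + p) = -(B₁' + v) := by linear_combination hv + a6
  have e4 : D₁' + (v + p) = -(A₁' + v) := by linear_combination hv + a5
  have e5 : C₂ + (v + p) = A₂ + v := by linear_combination -b5
  have e6 : D₂ + (v + p) = B₂ + v := by linear_combination -b6
  rw [e1, e2, e3, e4, e5, e6, map_neg, map_neg, neg_neg] at hcL
  have hd : Real.cos θ₁ * Real.sin θ₂ - Real.sin θ₁ * Real.cos θ₂ ≠ 0 := by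
    rw [Real.sin_sub] at hδ
    intro h
    linarith
  have e7 := hA₁.dirComp_eq hA₁'
  have e8 := hC₁.dirComp_eq hC₁'
  have e9 := hA₂.dirComp_eq hA₂'
  have e10 := hD₂.dirComp_eq hD₂'
  simp only [dirComp_add_pi] at e10
  rcases CornerBox.eq_or_eq (hKL.image_planeMap hd _ _ _ _) hcK hcL with h | h
  · apply n1
    rw [← sub_eq_zero]
    apply eq_zero_of_dirComp_eq_zero hδ.ne'
    · rw [← a1]
      simp only [map_sub]
      linarith
    · have := congrArg (dirComp θ₂) e3
      simp only [map_sub, map_add, map_neg] at this h ⊢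
      linarith
  · apply n2
    rw [← sub_eq_zero]
    apply eq_zero_of_dirComp_eq_zero hδ.ne'
    · have h1 := congrArg (dirComp θ₁) e6
      have h2 := congrArg (dirComp θ₁) hv
      simp only [map_sub, map_add, map_neg, map_zero] at h1 h2 h ⊢
      linarith
    · rw [← b3]
      simp only [map_sub, map_neg]
      linarith

theorem Homometric.isClosedK {K L : Set (ℝ × ℝ)} (hKL : Homometric K L) : IsClosed K :=
  hKL.isCompactK.isClosed

/-- Homometric polygons agree up to translation and reflection. -/
theorem Homometric.exists_mem_iff {K L : Set (ℝ × ℝ)} (hKL : Homometric K L) :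
    ∃ p, (∀ z, z ∈ K ↔ z - p ∈ L) ∨ ∀ z, z ∈ K ↔ p - z ∈ L := by
  have o1 : (1 : ℝ) = 1 ∨ (1 : ℝ) = -1 := Or.inl rfl
  rcases hKL.forall_isLocallyDir with h | h
  · obtain ⟨p, hp⟩ := exists_eq_dirComp_of_isPreconnected isPreconnected_univ fun θ _ => h θ
    exact ⟨p, Or.inl <| mem_iff_of_supp_sub_eq hKL.convexK hKL.isClosedK hKL.symm.convexK
      hKL.symm.isClosedK (hKL.exists_isVert o1) (hKL.symm.exists_isVert o1)
      fun θ => hp θ (Set.mem_univ θ)⟩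
  · obtain ⟨p, hp⟩ := exists_eq_dirComp_of_isPreconnected isPreconnected_univ fun θ _ => h θ
    refine ⟨p, Or.inr fun z => ?_⟩
    have hc : Convex ℝ (Neg.neg ⁻¹' L) := hKL.symm.convexK.linear_preimage (-LinearMap.id)
    rw [mem_iff_of_supp_sub_eq hKL.convexK hKL.isClosedK hc
      (hKL.symm.isClosedK.preimage continuous_neg) (hKL.exists_isVert o1) (fun θ => ?_)
      fun θ => hp θ (Set.mem_univ θ), Set.mem_preimage, neg_sub]
    obtain ⟨S, hS⟩ := hKL.symm.exists_isVert o1 (θ + Real.pi)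
    exact ⟨_, isVert_neg hS⟩

section volume

variable {K L : Set (ℝ × ℝ)}

theorem isFat_of_interior (hK : (interior K).Nonempty) : IsFat K := by
  obtain ⟨c, hc⟩ := hK
  intro α β hαβ
  have hcont : Continuous fun ε : ℝ => c + ε • ((α, β) : ℝ × ℝ) := by fun_prop
  have h0 : ∀ᶠ ε in 𝓝 (0 : ℝ), c + ε • ((α, β) : ℝ × ℝ) ∈ K := by
    apply hcont.tendsto' 0 c (by simp)
    exact mem_interior_iff_mem_nhds.1 hc
  obtain ⟨ε, h1, h2⟩ := ((h0.filter_mono nhdsWithin_le_nhds).and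
    (self_mem_nhdsWithin : Set.Ioi (0 : ℝ) ∈ 𝓝[>] 0)).exists
  refine ⟨c, interior_subset hc, _, h1, ?_⟩
  have h3 : 0 < α ^ 2 + β ^ 2 := by rcases hαβ with h | h <;> positivity
  have h4 := mul_pos (Set.mem_Ioi.1 h2) h3
  simp only [Prod.fst_add, Prod.snd_add, Prod.smul_fst, Prod.smul_snd, smul_eq_mul]
  linarith

theorem exists_shift_of_volume_le (hK : Convex ℝ K) (hKi : (interior K).Nonempty)
    (hL : IsCompact L) (h : ∀ x, volume {z | z ∈ K ∧ z - x ∈ K} = volume {z | z ∈ L ∧ z - x ∈ L})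
    {x : ℝ × ℝ} (hx : ∃ y ∈ K, y - x ∈ K) : ∃ y ∈ L, y - x ∈ L := by
  obtain ⟨c, hc⟩ := hKi
  obtain ⟨y, hy, hyx⟩ := hx
  have hD : IsClosed ((fun w : (ℝ × ℝ) × (ℝ × ℝ) => w.1 - w.2) '' L ×ˢ L) :=
    ((hL.prod hL).image (by fun_prop)).isClosed
  have key : ∀ s : ℝ, 0 < s → s < 1 →
      s • x ∈ (fun w : (ℝ × ℝ) × (ℝ × ℝ) => w.1 - w.2) '' L ×ˢ L := by
    intro s hs0 hs1
    have h1 : (1 - s) • c + s • y ∈ interior K :=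
      hK.combo_interior_self_mem_interior hc hy (by linarith) hs0.le (by ring)
    have h2 : (1 - s) • c + s • (y - x) ∈ interior K :=
      hK.combo_interior_self_mem_interior hc hyx (by linarith) hs0.le (by ring)
    have h3 : IsOpen {z | z ∈ interior K ∧ z - s • x ∈ interior K} :=
      isOpen_interior.inter (isOpen_interior.preimage (by fun_prop))
    have h4 : 0 < volume {z | z ∈ K ∧ z - s • x ∈ K} := by
      refine lt_of_lt_of_le (h3.measure_pos volume ⟨_, h1, ?_⟩)
        (measure_mono fun z hz => ⟨interior_subset hz.1, interior_subset hz.2⟩)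
      convert h2 using 1
      module
    rw [h] at h4
    obtain ⟨z, hz, hz'⟩ := nonempty_of_measure_ne_zero h4.ne'
    exact ⟨(z, z - s • x), ⟨hz, hz'⟩, by simp⟩
  have hcont : Tendsto (fun s : ℝ => s • x) (𝓝[<] 1) (𝓝 x) := by
    have : Continuous fun s : ℝ => s • x := by fun_prop
    exact (this.tendsto' 1 x (one_smul _ _)).mono_left nhdsWithin_le_nhds
  obtain ⟨⟨a, b⟩, ⟨ha, hb⟩, hab⟩ := hD.mem_of_tendsto hcont (by
    filter_upwards [Ioo_mem_nhdsLT (zero_lt_one (α := ℝ))] with s hs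
    exact key s hs.1 hs.2)
  refine ⟨a, ha, ?_⟩
  rw [← hab]
  simpa using hb

/-- The inverse of the change of coordinates that maps `(1, 0)` to `x` and preserves areas. -/
noncomputable def chordCoord (x : ℝ × ℝ) : ℝ × ℝ →ᵃ[ℝ] ℝ × ℝ :=
  planeMap (x.1 / (x.1 ^ 2 + x.2 ^ 2)) (x.2 / (x.1 ^ 2 + x.2 ^ 2)) x.2 (-x.1) 0 0

variable {x : ℝ × ℝ}

theorem chordCoord_snd (x y : ℝ × ℝ) : (chordCoord x y).2 = cross x y := by
  simp only [chordCoord, planeMap_apply, cross]; ring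

theorem sq_add_sq_pos_of_ne_zero (hx : x ≠ 0) : 0 < x.1 ^ 2 + x.2 ^ 2 := by
  by_contra! h
  apply hx
  ext <;> simp only [Prod.fst_zero, Prod.snd_zero] <;> nlinarith [sq_nonneg x.1, sq_nonneg x.2]

theorem chordCoord_sub_smul (hx : x ≠ 0) (s : ℝ) (y : ℝ × ℝ) :
    chordCoord x (y - s • x) = chordCoord x y - (s, 0) := by
  have := (sq_add_sq_pos_of_ne_zero hx).ne'
  ext <;> simp only [chordCoord, planeMap_apply, Prod.fst_sub, Prod.snd_sub, Prod.smul_fst,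
    Prod.smul_snd, smul_eq_mul]
  · field_simp; ring
  · ring

theorem chordCoord_injective (hx : x ≠ 0) : Function.Injective (chordCoord x) := by
  apply planeMap_injective
  have := (sq_add_sq_pos_of_ne_zero hx).ne'
  have h : x.1 / (x.1 ^ 2 + x.2 ^ 2) * -x.1 - x.2 / (x.1 ^ 2 + x.2 ^ 2) * x.2 = -1 := by
    field_simp; ring
  rw [h]; norm_num

theorem mem_longChords_image_chordCoord (hx : x ≠ 0) {t : ℝ} :
    t ∈ longChords (chordCoord x '' K) 1 ↔ ∃ y ∈ K, y - x ∈ K ∧ cross x y = t := by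
  have hs : ∀ y, chordCoord x y - (1, 0) = chordCoord x (y - x) := by
    intro y; rw [← chordCoord_sub_smul hx, one_smul]
  constructor
  · rintro ⟨r, ⟨y, hy, hyr⟩, h⟩
    have : ((r - 1, t) : ℝ × ℝ) = chordCoord x y - (1, 0) := by rw [hyr]; simp
    rw [this, hs, (chordCoord_injective hx).mem_set_image] at h
    exact ⟨y, hy, h, by rw [← chordCoord_snd, hyr]⟩
  · rintro ⟨y, hy, hyx, rfl⟩
    refine ⟨(chordCoord x y).1, ⟨y, hy, by rw [← chordCoord_snd]⟩, y - x, hyx, ?_⟩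
    rw [← hs, ← chordCoord_snd]
    ext <;> simp

theorem longChords_image_chordCoord (hK : Convex ℝ K) (hx : x ≠ 0) {b d : ℝ × ℝ}
    (h : IsExt K x b d) :
    longChords (chordCoord x '' K) 1 = Set.Icc (cross x d) (cross x b) := by
  obtain ⟨hb, hb', hd, hd', h⟩ := h
  ext t
  rw [mem_longChords_image_chordCoord hx]
  constructor
  · rintro ⟨y, hy, hyx, rfl⟩
    exact h y hy hyx
  · intro ht
    have hle := ht.1.trans ht.2
    rw [← segment_eq_Icc hle] at ht
    obtain ⟨u, v, hu, hv, huv, rfl⟩ := ht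
    refine ⟨u • d + v • b, hK hd hb hu hv huv, ?_, ?_⟩
    · convert hK hd' hb' hu hv huv using 1
      have : x = (u + v) • x := by rw [huv, one_smul]
      conv_lhs => rw [this]
      module
    · simp only [cross, Prod.fst_add, Prod.snd_add, Prod.smul_fst, Prod.smul_snd, smul_eq_mul]
      ring

theorem volume_image_chordCoord_inter (hx : x ≠ 0) (s : ℝ) :
    volume {z | z ∈ chordCoord x '' K ∧ z - (s, 0) ∈ chordCoord x '' K} =
      ENNReal.ofReal |LinearMap.det (chordCoord x).linear| *
        volume {z | z ∈ K ∧ z - s • x ∈ K} := by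
  rw [← Measure.addHaar_image_linearMap]
  congr 1
  have hlin : ∀ z, (chordCoord x).linear z = chordCoord x z := by
    intro z
    simp [chordCoord, planeMap]
  ext w
  constructor
  · rintro ⟨⟨y, hy, rfl⟩, h⟩
    rw [← chordCoord_sub_smul hx, (chordCoord_injective hx).mem_set_image] at h
    exact ⟨y, ⟨hy, h⟩, hlin y⟩
  · rintro ⟨y, ⟨hy, h⟩, rfl⟩
    rw [hlin]
    refine ⟨⟨y, hy, rfl⟩, ?_⟩
    rw [← chordCoord_sub_smul hx]
    exact ⟨_, h, rfl⟩

theorem width_eq_of_volume_eq (hK : IsCompact K) (hL : IsCompact L) (hKc : Convex ℝ K)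
    (hLc : Convex ℝ L)
    (h : ∀ x, volume {z | z ∈ K ∧ z - x ∈ K} = volume {z | z ∈ L ∧ z - x ∈ L})
    {x b d b' d' : ℝ × ℝ} (hbd : IsExt K x b d) (hbd' : IsExt L x b' d') :
    cross x b - cross x d = cross x b' - cross x d' := by
  rcases eq_or_ne x 0 with rfl | hx
  · simp [cross]
  have hc : Continuous (chordCoord x) := (chordCoord x).continuous_of_finiteDimensional
  have hv : ∀ s : ℝ, volume {z | z ∈ chordCoord x '' K ∧ z - (s, 0) ∈ chordCoord x '' K} =
      volume {z | z ∈ chordCoord x '' L ∧ z - (s, 0) ∈ chordCoord x '' L} := by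
    intro s
    rw [volume_image_chordCoord_inter hx, volume_image_chordCoord_inter hx, h]
  have e : volume (longChords (chordCoord x '' K) 1) =
      volume (longChords (chordCoord x '' L) 1) :=
    le_antisymm
      (volume_longChords_one_le (hK.image hc) (hL.image hc) (hKc.affine_image _)
        (hLc.affine_image _) hv)
      (volume_longChords_one_le (hL.image hc) (hK.image hc) (hLc.affine_image _)
        (hKc.affine_image _) fun s => (hv s).symm)
  rw [longChords_image_chordCoord hKc hx hbd, longChords_image_chordCoord hLc hx hbd',
    Real.volume_Icc, Real.volume_Icc] at e
  have h1 := hbd.2.2.2.2 _ hbd.1 hbd.2.1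
  have h2 := hbd'.2.2.2.2 _ hbd'.1 hbd'.2.1
  exact (ENNReal.ofReal_eq_ofReal_iff (by linarith) (by linarith)).1 e

theorem Homometric.of_volume_eq (hK : ∃ V : Set (ℝ × ℝ), V.Finite ∧ K = convexHull ℝ V)
    (hL : ∃ V : Set (ℝ × ℝ), V.Finite ∧ L = convexHull ℝ V)
    (hKi : (interior K).Nonempty) (hLi : (interior L).Nonempty)
    (h : ∀ x, volume {z | z ∈ K ∧ z - x ∈ K} = volume {z | z ∈ L ∧ z - x ∈ L}) :
    Homometric K L := by
  have hKc : Convex ℝ K := by obtain ⟨V, -, rfl⟩ := hK; exact convex_convexHull ℝ V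
  have hLc : Convex ℝ L := by obtain ⟨V, -, rfl⟩ := hL; exact convex_convexHull ℝ V
  have hKk : IsCompact K := by
    obtain ⟨V, hV, rfl⟩ := hK; exact hV.isCompact_convexHull ℝ
  have hLk : IsCompact L := by
    obtain ⟨V, hV, rfl⟩ := hL; exact hV.isCompact_convexHull ℝ
  exact ⟨hK, hL, isFat_of_interior hKi, isFat_of_interior hLi,
    fun x => ⟨exists_shift_of_volume_le hKc hKi hLk h,
      exists_shift_of_volume_le hLc hLi hKk fun x => (h x).symm⟩,
    fun x b d b' d' h1 h2 => width_eq_of_volume_eq hKk hLk hKc hLc h h1 h2⟩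

end volume

/-- The Cartesian coordinates of a point of the Euclidean plane. -/
noncomputable def planeCoord : EuclideanSpace ℝ (Fin 2) ≃L[ℝ] ℝ × ℝ :=
  (EuclideanSpace.equiv (Fin 2) ℝ).trans (ContinuousLinearEquiv.finTwoArrow ℝ ℝ)

theorem measurePreserving_planeCoord : MeasurePreserving planeCoord :=
  (volume_preserving_finTwoArrow ℝ).comp (PiLp.volume_preserving_ofLp (Fin 2))

theorem volume_image_planeCoord_inter (P : Set (EuclideanSpace ℝ (Fin 2)))
    (x : EuclideanSpace ℝ (Fin 2)) :
    volume {z | z ∈ planeCoord '' P ∧ z - planeCoord x ∈ planeCoord '' P} =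
      volume (P ∩ ((fun p => p + x) '' P)) := by
  rw [← measurePreserving_planeCoord.measure_preimage_emb
    planeCoord.toHomeomorph.measurableEmbedding]
  congr 1
  ext z
  have h : planeCoord z - planeCoord x = planeCoord (z - x) := (map_sub _ _ _).symm
  rw [Set.mem_preimage, Set.mem_ofPred_eq, h, planeCoord.injective.mem_set_image,
    planeCoord.injective.mem_set_image, Set.image_add_right, sub_eq_add_neg]
  rfl

theorem stmt_5 (P P' : Set (EuclideanSpace ℝ (Fin 2)))
    (V V' : Set (EuclideanSpace ℝ (Fin 2)))
    (hV : V.Finite) (hV' : V'.Finite)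
    (hP : P = convexHull ℝ V) (hP' : P' = convexHull ℝ V')
    (hPint : (interior P).Nonempty) (hP'int : (interior P').Nonempty)
    (hcov : ∀ x : EuclideanSpace ℝ (Fin 2), covariogram P x = covariogram P' x) :
    ∃ (v : EuclideanSpace ℝ (Fin 2)) (ε : ℝ), (ε = 1 ∨ ε = -1) ∧
      P' = (fun x => ε • x + v) '' P := by
  have hfin : ∀ {Q W : Set (EuclideanSpace ℝ (Fin 2))}, W.Finite → Q = convexHull ℝ W →
      ∀ S, volume (Q ∩ S) ≠ ⊤ := by
    rintro _ W hW rfl S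
    exact measure_ne_top_of_subset Set.inter_subset_left
      (hW.isCompact_convexHull ℝ).measure_lt_top.ne
  have hpoly : ∀ {Q W : Set (EuclideanSpace ℝ (Fin 2))}, W.Finite → Q = convexHull ℝ W →
      ∃ V : Set (ℝ × ℝ), V.Finite ∧ planeCoord '' Q = convexHull ℝ V := by
    rintro _ W hW rfl
    exact ⟨_, hW.image planeCoord,
      LinearMap.image_convexHull (planeCoord : EuclideanSpace ℝ (Fin 2) →ₗ[ℝ] ℝ × ℝ) W⟩
  have hint : ∀ {Q : Set (EuclideanSpace ℝ (Fin 2))}, (interior Q).Nonempty →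
      (interior (planeCoord '' Q)).Nonempty := by
    intro Q hQ
    have := planeCoord.toHomeomorph.image_interior Q
    exact this ▸ hQ.image _
  have hH : Homometric (planeCoord '' P') (planeCoord '' P) := by
    refine .of_volume_eq (hpoly hV' hP') (hpoly hV hP) (hint hP'int) (hint hPint) fun x => ?_
    obtain ⟨x, rfl⟩ := planeCoord.surjective x
    rw [volume_image_planeCoord_inter, volume_image_planeCoord_inter]
    exact (ENNReal.toReal_eq_toReal_iff' (hfin hV' hP' _) (hfin hV hP _)).1 (hcov x).symm
  obtain ⟨p, hp⟩ := hH.exists_mem_iff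
  obtain ⟨v, rfl⟩ := planeCoord.surjective p
  rcases hp with hp | hp
  · refine ⟨v, 1, Or.inl rfl, Set.ext fun z => ?_⟩
    have h := hp (planeCoord z)
    rw [← map_sub, planeCoord.injective.mem_set_image, planeCoord.injective.mem_set_image] at h
    rw [h]
    constructor
    · intro hz
      exact ⟨_, hz, by simp⟩
    · rintro ⟨y, hy, rfl⟩
      simpa using hy
  · refine ⟨v, -1, Or.inr rfl, Set.ext fun z => ?_⟩
    have h := hp (planeCoord z)
    rw [← map_sub, planeCoord.injective.mem_set_image, planeCoord.injective.mem_set_image] at h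
    rw [h]
    constructor
    · intro hz
      exact ⟨_, hz, by simp⟩
    · rintro ⟨y, hy, rfl⟩
      simpa using hy
end

section
/- Let σ : ℝ^{n−1} → ℝ^n have components σ_j(t) = p_j(t)/q_j(t) (j = 1,…,n) for real polynomials p_j, q_j in n−1 variables, and let O ⊆ ℝ^{n−1} be an open set on which all q_j and also σ₁ are nonvanishing, such that σ(O) is not contained in any affine hyperplane of ℝ^n and there exists t ∈ O such that σ̂(t) := (σ₂(t)/σ₁(t), …, σ_n(t)/σ₁(t)) is an interior point of σ̂(O) in ℝ^{n−1}. Let v_1, …, v_m be distinct points of ℝ^n and, for k = 1, …, m, let P_k(s) = f_k(s)/h_k(s) be a quotient of homogeneous real polynomials f_k, h_k in n variables with deg f_k − deg h_k = d for all k, where each h_k is nonvanishing at every point of σ(O). If the E-function F(s) = Σ_{k=1}^m P_k(s) e^{−i v_k·s} vanishes at every point s ∈ σ(O), then every numerator f_k is the zero polynomial. -/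
open MeasureTheory RealInnerProductSpace

theorem Polynomial.wronskian_mul_mul {R : Type*} [CommRing R] (g a b : Polynomial R) :
    wronskian (g * a) (g * b) = g ^ 2 * wronskian a b := by
  simp only [wronskian, derivative_mul]
  ring

theorem Polynomial.exists_isCoprime_of_ne_zero {K : Type*} [Field K] (a b : Polynomial K)
    (hb : b ≠ 0) : ∃ g a' b', g ≠ 0 ∧ b' ≠ 0 ∧ IsCoprime a' b' ∧ a = g * a' ∧ b = g * b' := by
  classical
  have hg : EuclideanDomain.gcd a b ≠ 0 := fun h => hb (EuclideanDomain.gcd_eq_zero_iff.mp h).2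
  obtain ⟨b', hb'⟩ := EuclideanDomain.gcd_dvd_right a b
  obtain ⟨a', ha'⟩ := EuclideanDomain.gcd_dvd_left a b
  refine ⟨_, a', b', hg, ?_, ?_, ha', hb'⟩
  · rintro rfl
    exact hb (by simpa using hb')
  · have h := EuclideanDomain.gcd_eq_gcd_ab a b
    refine ⟨EuclideanDomain.gcdA a b, EuclideanDomain.gcdB a b, mul_left_cancel₀ hg ?_⟩
    conv_rhs => rw [mul_one, h]
    conv_rhs =>
      arg 1
      arg 1
      rw [ha']
    conv_rhs =>
      arg 2
      arg 1
      rw [hb']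
    ring

theorem Polynomial.exists_eq_C_mul_of_wronskian_eq_zero {K : Type*} [Field K] [CharZero K]
    {a b : Polynomial K} (hb : b ≠ 0) (h : wronskian a b = 0) : ∃ c, a = C c * b := by
  obtain ⟨g, a', b', hg, hb', hc, rfl, rfl⟩ := exists_isCoprime_of_ne_zero a b hb
  rw [wronskian_mul_mul, mul_eq_zero, or_iff_right (pow_ne_zero 2 hg),
    hc.wronskian_eq_zero_iff] at h
  obtain ⟨α, hα⟩ := natDegree_eq_zero.mp (derivative_eq_zero.mp h.1)
  obtain ⟨β, hβ⟩ := natDegree_eq_zero.mp (derivative_eq_zero.mp h.2)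
  have hβ0 : β ≠ 0 := by
    rintro rfl
    exact hb' (by simpa using hβ.symm)
  refine ⟨α / β, ?_⟩
  rw [← hα, ← hβ, mul_left_comm, ← C_mul, div_mul_cancel₀ _ hβ0]

theorem Polynomial.rootMultiplicity_le_wronskian {K : Type*} [Field K] (P Q : Polynomial K)
    (hw : wronskian P Q ≠ 0) (z : K) :
    rootMultiplicity z (P * Q) ≤ rootMultiplicity z (wronskian P Q) + 1 := by
  have hP : P ≠ 0 := by rintro rfl; simp at hw
  have hQ : Q ≠ 0 := by rintro rfl; simp at hw
  rw [rootMultiplicity_mul (mul_ne_zero hP hQ)]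
  have key : ∀ S : Polynomial K, ∀ k ≤ rootMultiplicity z S, (X - C z) ^ (k - 1) ∣ derivative S :=
    fun S k hk => pow_sub_one_dvd_derivative_of_pow_dvd
      ((pow_dvd_pow _ hk).trans (pow_rootMultiplicity_dvd S z))
  rw [← Nat.sub_le_iff_le_add, le_rootMultiplicity_iff hw]
  refine dvd_sub ?_ ?_
  · refine (pow_dvd_pow _ ?_).trans ((pow_add (X - C z) _ _).dvd.trans
      (mul_dvd_mul (pow_rootMultiplicity_dvd P z) (key Q _ le_rfl)))
    omega
  · refine (pow_dvd_pow _ ?_).trans ((pow_add (X - C z) _ _).dvd.trans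
      (mul_dvd_mul (key P _ le_rfl) (pow_rootMultiplicity_dvd Q z)))
    omega

theorem Polynomial.rootMultiplicity_wronskian_lt {K : Type*} [Field K] [CharZero K]
    {a b : Polynomial K} (hab : IsCoprime a b) (hb : b ≠ 0) (hw : wronskian a b ≠ 0) {z : K}
    (hz : b.IsRoot z) :
    rootMultiplicity z (wronskian a b) < rootMultiplicity z b := by
  by_contra! hle
  have h1 : (X - C z) ^ rootMultiplicity z b ∣ wronskian a b :=
    (pow_dvd_pow _ hle).trans (pow_rootMultiplicity_dvd _ z)
  have h2 : (X - C z) ^ rootMultiplicity z b ∣ a * derivative b := by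
    have := dvd_add h1 ((pow_rootMultiplicity_dvd b z).mul_left (derivative a))
    rwa [wronskian, sub_add_cancel] at this
  have h3 : IsCoprime ((X - C z) ^ rootMultiplicity z b) a :=
    (hab.symm.of_isCoprime_of_dvd_left (pow_rootMultiplicity_dvd b z))
  have h4 := h3.dvd_of_dvd_mul_left h2
  have hpos : 0 < rootMultiplicity z b := (rootMultiplicity_pos hb).mpr hz
  have hd : derivative b ≠ 0 := by
    intro h0
    obtain ⟨β, rfl⟩ := natDegree_eq_zero.mp (derivative_eq_zero.mp h0)
    simp at hpos
  rw [← le_rootMultiplicity_iff hd, derivative_rootMultiplicity_of_root hz] at h4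
  omega

theorem Polynomial.wronskian_eq_zero_of_mul_wronskian_eq {K : Type*} [Field K] [CharZero K]
    [IsAlgClosed K] {a b P Q : Polynomial K} {c : K} (hb : b ≠ 0) (hP : P ≠ 0) (hQ : Q ≠ 0)
    (hc : c ≠ 0) (h : b ^ 2 * wronskian P Q = C c * wronskian a b * (P * Q)) :
    wronskian a b = 0 := by
  obtain ⟨g, a', b', hg, hb', hco, rfl, rfl⟩ := exists_isCoprime_of_ne_zero a b hb
  rw [wronskian_mul_mul] at h ⊢
  have h' : b' ^ 2 * wronskian P Q = C c * wronskian a' b' * (P * Q) :=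
    mul_left_cancel₀ (pow_ne_zero 2 hg) (by linear_combination h)
  by_contra hne
  have hw : wronskian a' b' ≠ 0 := right_ne_zero_of_mul hne
  have hR : C c * wronskian a' b' * (P * Q) ≠ 0 :=
    mul_ne_zero (mul_ne_zero (C_ne_zero.mpr hc) hw) (mul_ne_zero hP hQ)
  have hW : wronskian P Q ≠ 0 := right_ne_zero_of_mul (h' ▸ hR)
  by_cases hdeg : b'.degree = 0
  · have hb0 : b'.natDegree = 0 := natDegree_eq_of_degree_eq_some hdeg
    have h1 := congrArg natDegree h'
    rw [natDegree_mul (pow_ne_zero 2 hb') hW, natDegree_mul (left_ne_zero_of_mul hR)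
      (mul_ne_zero hP hQ), natDegree_mul hP hQ, natDegree_pow, hb0] at h1
    have := natDegree_wronskian_lt_add hW
    omega
  · obtain ⟨z, hz⟩ := IsAlgClosed.exists_root b' hdeg
    have h1 := congrArg (rootMultiplicity z) h'
    rw [rootMultiplicity_mul (h' ▸ hR), rootMultiplicity_mul hR,
      rootMultiplicity_mul (left_ne_zero_of_mul hR), pow_two,
      rootMultiplicity_mul (mul_ne_zero hb' hb'), rootMultiplicity_C] at h1
    have h2 := rootMultiplicity_le_wronskian P Q hW z
    have h3 := rootMultiplicity_wronskian_lt hco hb' hw hz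
    omega

theorem Polynomial.hasDerivAt_eval_mul_cexp (P a b : Polynomial ℂ) (x : ℝ)
    (hb : b.eval (x : ℂ) ≠ 0) :
    HasDerivAt (fun y : ℝ => P.eval (y : ℂ) *
        Complex.exp (-(Complex.I * (a.eval (y : ℂ) / b.eval (y : ℂ)))))
      ((b ^ 2 * derivative P + C Complex.I * wronskian a b * P).eval (x : ℂ) /
        b.eval (x : ℂ) ^ 2 *
          Complex.exp (-(Complex.I * (a.eval (x : ℂ) / b.eval (x : ℂ))))) x := by
  have hq := (((a.hasDerivAt (x : ℂ)).div (b.hasDerivAt (x : ℂ)) hb).const_mul Complex.I).neg.cexp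
  have h := ((P.hasDerivAt (x : ℂ)).mul hq).comp_ofReal
  refine h.congr_deriv ?_
  simp only [wronskian, eval_add, eval_mul, eval_pow, eval_C, eval_sub, Pi.div_apply, Pi.neg_apply]
  field_simp
  ring

theorem Polynomial.eq_zero_of_sum_mul_cexp_eq_zero {ι : Type*} (s : Finset ι)
    (a : ι → Polynomial ℂ) (b : Polynomial ℂ) (U : Set ℝ) (hU : IsOpen U) (hne : U.Nonempty)
    (hb : ∀ x ∈ U, b.eval (x : ℂ) ≠ 0)
    (ha : ∀ k ∈ s, ∀ l ∈ s, k ≠ l → wronskian (a k - a l) b ≠ 0) (P : ι → Polynomial ℂ)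
    (h : ∀ x ∈ U, ∑ k ∈ s, (P k).eval (x : ℂ) *
      Complex.exp (-(Complex.I * ((a k).eval (x : ℂ) / b.eval (x : ℂ)))) = 0) :
    ∀ k ∈ s, P k = 0 := by
  classical
  have hinf : (((↑) : ℝ → ℂ) '' U).Infinite :=
    (Set.infinite_image_iff Complex.ofReal_injective.injOn).mpr
      (hne.elim fun x hx => infinite_of_mem_nhds x (hU.mem_nhds hx))
  have hb0 : b ≠ 0 := by
    rintro rfl
    obtain ⟨x, hx⟩ := hne
    simpa using hb x hx
  induction s using Finset.induction_on generalizing P with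
  | empty => simp
  | insert i s hi ih =>
    have ha' : ∀ k ∈ s, ∀ l ∈ s, k ≠ l → wronskian (a k - a l) b ≠ 0 := fun k hk l hl =>
      ha k (Finset.mem_insert_of_mem hk) l (Finset.mem_insert_of_mem hl)
    by_cases hPi : P i = 0
    · have := ih ha' P (fun x hx => by simpa [Finset.sum_insert hi, hPi] using h x hx)
      simpa [hPi] using this
    set T : ι → Polynomial ℂ := fun k =>
      b ^ 2 * derivative (P k) + C Complex.I * wronskian (a k) b * P k with hT
    have hTsum : ∀ x ∈ U, ∑ k ∈ insert i s, (T k).eval (x : ℂ) *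
        Complex.exp (-(Complex.I * ((a k).eval (x : ℂ) / b.eval (x : ℂ)))) = 0 := by
      intro x hx
      have h1 := HasDerivAt.fun_sum (u := insert i s)
        (fun k _ => hasDerivAt_eval_mul_cexp (P k) (a k) b x (hb x hx))
      have h2 := h1.unique ((hasDerivAt_const x (0 : ℂ)).congr_of_eventuallyEq
        (Filter.eventually_of_mem (hU.mem_nhds hx) h))
      have h3 := congrArg (b.eval (x : ℂ) ^ 2 * ·) h2
      simp only [Finset.mul_sum, mul_zero] at h3
      rw [← h3]
      refine Finset.sum_congr rfl fun k _ => ?_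
      rw [← mul_assoc, mul_div_cancel₀ _ (pow_ne_zero 2 (hb x hx))]
    have hD : ∀ k ∈ s, P i * T k - T i * P k = 0 := by
      refine ih ha' _ fun x hx => ?_
      have h1 : ∑ k ∈ insert i s, (P i * T k - T i * P k).eval (x : ℂ) *
          Complex.exp (-(Complex.I * ((a k).eval (x : ℂ) / b.eval (x : ℂ)))) = 0 := by
        calc _ = (P i).eval (x : ℂ) * ∑ k ∈ insert i s, (T k).eval (x : ℂ) *
              Complex.exp (-(Complex.I * ((a k).eval (x : ℂ) / b.eval (x : ℂ)))) -
              (T i).eval (x : ℂ) * ∑ k ∈ insert i s, (P k).eval (x : ℂ) *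
              Complex.exp (-(Complex.I * ((a k).eval (x : ℂ) / b.eval (x : ℂ)))) := by
              rw [Finset.mul_sum, Finset.mul_sum, ← Finset.sum_sub_distrib]
              refine Finset.sum_congr rfl fun k _ => ?_
              simp only [eval_sub, eval_mul]
              ring
          _ = 0 := by rw [hTsum x hx, h x hx, mul_zero, mul_zero, sub_zero]
      rw [Finset.sum_insert hi] at h1
      simpa only [mul_comm (T i) (P i), sub_self, eval_zero, zero_mul, zero_add] using h1
    have hs : ∀ k ∈ s, P k = 0 := by
      intro k hk
      by_contra hPk
      have hki : k ≠ i := fun e => hi (e ▸ hk)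
      refine ha k (Finset.mem_insert_of_mem hk) i (Finset.mem_insert_self i s) hki
        (wronskian_eq_zero_of_mul_wronskian_eq (c := -Complex.I) hb0 hPi hPk
          (neg_ne_zero.mpr Complex.I_ne_zero) ?_)
      have h1 := hD k hk
      simp only [hT, wronskian] at h1
      simp only [wronskian, derivative_sub, C_neg]
      linear_combination h1
    refine absurd ?_ hPi
    refine eq_zero_of_infinite_isRoot _ (hinf.mono ?_)
    rintro _ ⟨x, hx, rfl⟩
    have h1 := h x hx
    rw [Finset.sum_insert hi, Finset.sum_eq_zero fun k hk => by rw [hs k hk, eval_zero, zero_mul],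
      add_zero] at h1
    exact (mul_eq_zero.mp h1).resolve_right (Complex.exp_ne_zero _)

theorem MvPolynomial.IsHomogeneous.eval_mul_left {ι R : Type*} [CommSemiring R]
    {P : MvPolynomial ι R} {e : ℕ} (hP : P.IsHomogeneous e) (c : R) (x : ι → R) :
    eval (fun i => c * x i) P = c ^ e * eval x P := by
  simp only [eval_eq, Finset.mul_sum]
  refine Finset.sum_congr rfl fun k hk => ?_
  have hdeg : ∑ i ∈ k.support, k i = e := by
    have := hP (mem_support_iff.mp hk)
    rwa [Finsupp.weight_apply, Finsupp.sum, Finset.sum_congr rfl fun i _ => by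
      rw [Pi.one_apply, smul_eq_mul, mul_one]] at this
  simp only [mul_pow, Finset.prod_mul_distrib, Finset.prod_pow_eq_pow_sum, hdeg]
  ring

theorem MvPolynomial.eq_zero_of_eval_eq_zero_on_isOpen {n : ℕ} (P : MvPolynomial (Fin n) ℝ)
    (U : Set (EuclideanSpace ℝ (Fin n))) (hU : IsOpen U) (hne : U.Nonempty)
    (h : ∀ y ∈ U, eval (fun i => y i) P = 0) : P = 0 := by
  obtain ⟨y, hy⟩ := hne
  have hV : IsOpen ((WithLp.toLp 2) ⁻¹' U : Set (Fin n → ℝ)) :=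
    hU.preimage (PiLp.continuous_toLp 2 _)
  obtain ⟨I, hI, hIV⟩ := isOpen_pi_iff'.mp hV (fun i => y i) hy
  refine funext_set I (fun i => infinite_of_mem_nhds _ ((hI i).1.mem_nhds (hI i).2)) fun x hx => ?_
  rw [map_zero]
  exact h _ (hIV hx)

/-- The restriction of a polynomial in several variables to the line `x ↦ t + x • u`. -/
noncomputable def MvPolynomial.restrictLine {ι : Type*} (t u : ι → ℝ) :
    MvPolynomial ι ℝ →ₐ[ℝ] Polynomial ℝ :=
  aeval fun i => Polynomial.C (t i) + Polynomial.X * Polynomial.C (u i)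

theorem MvPolynomial.eval_restrictLine {ι : Type*} (t u : ι → ℝ) (P : MvPolynomial ι ℝ) (x : ℝ) :
    (restrictLine t u P).eval x = eval (fun i => t i + x * u i) P := by
  rw [restrictLine, ← Polynomial.coe_evalRingHom, aeval_def, hom_eval₂, eval, coe_eval₂Hom]
  congr 1
  · ext; simp
  · ext i; simpa using mul_comm _ _

theorem MvPolynomial.eval_eq_zero_of_sum_mul_cexp_eq_zero {n : ℕ} {ι : Type*} [Fintype ι]
    (G P : ι → MvPolynomial (Fin n) ℝ) (Q : MvPolynomial (Fin n) ℝ)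
    (O : Set (EuclideanSpace ℝ (Fin n))) (hO : IsOpen O)
    (hQ : ∀ t ∈ O, eval (fun i => t i) Q ≠ 0)
    (hG : ∀ k l, k ≠ l → ∀ c : ℝ, G k - G l ≠ C c * Q)
    (h : ∀ t ∈ O, ∑ k, ((eval (fun i => t i) (P k) : ℝ) : ℂ) *
      Complex.exp (-(Complex.I * ((eval (fun i => t i) (G k) / eval (fun i => t i) Q : ℝ) : ℂ)))
        = 0) :
    ∀ k, ∀ t ∈ O, eval (fun i => t i) (P k) = 0 := by
  classical
  intro k₀ t ht
  set D : ι × ι → MvPolynomial (Fin n) ℝ := fun kl =>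
    C (eval (fun i => t i) Q) * (G kl.1 - G kl.2) - C (eval (fun i => t i) (G kl.1 - G kl.2)) * Q
    with hD
  have hD0 : ∏ kl ∈ Finset.univ.offDiag, D kl ≠ 0 := by
    refine Finset.prod_ne_zero_iff.mpr fun kl hkl h0 => ?_
    refine hG kl.1 kl.2 (Finset.mem_offDiag.mp hkl).2.2
      (eval (fun i => t i) (G kl.1 - G kl.2) / eval (fun i => t i) Q) ?_
    have hC : (C (eval (fun i => t i) Q) : MvPolynomial (Fin n) ℝ) ≠ 0 :=
      fun h => hQ t ht (C_eq_zero.mp h)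
    refine mul_left_cancel₀ hC ?_
    rw [← mul_assoc, ← C_mul, mul_div_cancel₀ _ (hQ t ht)]
    exact sub_eq_zero.mp h0
  obtain ⟨y, hy⟩ : ∃ y, eval y (∏ kl ∈ Finset.univ.offDiag, D kl) ≠ 0 := by
    by_contra! hall
    exact hD0 (funext fun y => by rw [hall y, map_zero])
  rw [map_prod, Finset.prod_ne_zero_iff] at hy
  obtain ⟨r, hre⟩ : ∃ r : MvPolynomial (Fin n) ℝ →+* Polynomial ℂ, ∀ S (x : ℝ),
      (r S).eval (x : ℂ) = ((eval (fun i => t i + x * (y i - t i)) S : ℝ) : ℂ) := by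
    refine ⟨(Polynomial.mapRingHom Complex.ofRealHom).comp
      (restrictLine (fun i => t i) (fun i => y i - t i)).toRingHom, fun S x => ?_⟩
    rw [← eval_restrictLine]
    exact Polynomial.eval_map_apply (f := Complex.ofRealHom) x
  have hr0 : ∀ S, (r S).eval 0 = ((eval (fun i => t i) S : ℝ) : ℂ) := by
    intro S
    simpa using hre S 0
  have hr1 : ∀ S, (r S).eval 1 = ((eval y S : ℝ) : ℂ) := by
    intro S
    simpa using hre S 1
  obtain ⟨γ, hγ, hγc⟩ : ∃ γ : ℝ → EuclideanSpace ℝ (Fin n),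
      (∀ x i, γ x i = t i + x * (y i - t i)) ∧ Continuous γ :=
    ⟨fun x => WithLp.toLp 2 fun i => t i + x * (y i - t i), fun _ _ => rfl, by fun_prop⟩
  have hγ0 : γ 0 = t := by
    ext i
    simp [hγ]
  simp only [← hγ] at hre
  have hb : ∀ x ∈ γ ⁻¹' O, (r Q).eval (x : ℂ) ≠ 0 := by
    intro x hx
    rw [hre]
    exact Complex.ofReal_ne_zero.mpr (hQ _ hx)
  have hrQ : r Q ≠ 0 := by
    intro h0
    have := hr0 Q
    rw [h0, Polynomial.eval_zero] at this
    exact hQ t ht (Complex.ofReal_eq_zero.mp this.symm)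
  have key := Polynomial.eq_zero_of_sum_mul_cexp_eq_zero Finset.univ (fun k => r (G k)) (r Q) _
    (hO.preimage hγc) ⟨0, by rwa [Set.mem_preimage, hγ0]⟩ hb ?_ (fun k => r (P k)) ?_ k₀ (Finset.mem_univ _)
  · have := hr0 (P k₀)
    rw [key, Polynomial.eval_zero] at this
    exact Complex.ofReal_eq_zero.mp this.symm
  · intro k _ l _ hkl hw
    obtain ⟨c, hc⟩ := Polynomial.exists_eq_C_mul_of_wronskian_eq_zero hrQ hw
    rw [← map_sub] at hc
    have h0 := congrArg (Polynomial.eval 0) hc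
    have h1 := congrArg (Polynomial.eval 1) hc
    rw [Polynomial.eval_mul, Polynomial.eval_C, hr0, hr0] at h0
    rw [Polynomial.eval_mul, Polynomial.eval_C, hr1, hr1] at h1
    refine hy (k, l) (by simpa using hkl) ?_
    rw [← Complex.ofReal_eq_zero]
    simp only [hD, eval_mul, eval_C, map_sub (eval y), Complex.ofReal_sub, Complex.ofReal_mul]
    rw [← Complex.ofReal_sub, ← map_sub, h1, h0]
    ring
  · intro x hx
    simp only [hre]
    simpa only [Complex.ofReal_div] using h _ hx

theorem MvPolynomial.IsHomogeneous.eq_zero_of_eval_cons_one {n e : ℕ}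
    {P : MvPolynomial (Fin (n + 1)) ℝ} (hP : P.IsHomogeneous e)
    (U : Set (EuclideanSpace ℝ (Fin n))) (hU : IsOpen U) (hne : U.Nonempty)
    (h : ∀ y ∈ U, eval (Fin.cons 1 fun i => y i : Fin (n + 1) → ℝ) P = 0) : P = 0 := by
  have hev : ∀ y : Fin n → ℝ, eval y (MvPolynomial.aeval (Fin.cons 1 X) P) =
      eval (Fin.cons 1 y : Fin (n + 1) → ℝ) P := by
    intro y
    rw [aeval_def, ← coe_eval₂Hom, ← RingHom.comp_apply]
    congr 1
    ext i
    · simp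
    · refine Fin.cases ?_ (fun j => ?_) i <;> simp
  have h0 := eq_zero_of_eval_eq_zero_on_isOpen (MvPolynomial.aeval (Fin.cons 1 X) P) U hU hne
    fun y hy => (hev _).trans (h y hy)
  have h1 : X 0 * P = 0 := by
    refine MvPolynomial.funext fun s => ?_
    rw [eval_mul, eval_X, map_zero, mul_eq_zero, or_iff_not_imp_left]
    intro hs
    have h2 := hP.eval_mul_left (s 0) (Fin.cons 1 fun j => s j.succ / s 0)
    rw [← hev, h0, map_zero, mul_zero] at h2
    rw [← h2]
    congr 2
    refine _root_.funext fun i => ?_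
    refine Fin.cases ?_ (fun j => ?_) i
    · simp
    · simp [mul_div_cancel₀ _ hs]
  exact (mul_eq_zero.mp h1).resolve_left (X_ne_zero 0)

theorem stmt_10 {n : ℕ}
    -- the rational components σ_j = p_j / q_j of the parametrization of ℝⁿ⁺¹ over ℝⁿ
    (p q : Fin (n + 1) → MvPolynomial (Fin n) ℝ)
    (σ : EuclideanSpace ℝ (Fin n) → EuclideanSpace ℝ (Fin (n + 1)))
    (hσ : ∀ t j, σ t j =
      MvPolynomial.eval (fun i => t i) (p j) / MvPolynomial.eval (fun i => t i) (q j))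
    -- the open parameter set on which all denominators and the first component are nonzero
    (O : Set (EuclideanSpace ℝ (Fin n))) (hO : IsOpen O)
    (hq : ∀ t ∈ O, ∀ j, MvPolynomial.eval (fun i => t i) (q j) ≠ 0)
    (hσ1 : ∀ t ∈ O, σ t 0 ≠ 0)
    -- hyperplane condition: σ(O) is contained in no affine hyperplane of ℝⁿ⁺¹
    (hHyp : ¬ ∃ (a : EuclideanSpace ℝ (Fin (n + 1))) (c : ℝ), a ≠ 0 ∧
      ∀ t ∈ O, ⟪a, σ t⟫ = c)
    -- inner point condition for the normalized function σ̂
    (σhat : EuclideanSpace ℝ (Fin n) → EuclideanSpace ℝ (Fin n))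
    (hσhat : ∀ t j, σhat t j = σ t j.succ / σ t 0)
    (hInner : ∃ t ∈ O, σhat t ∈ interior (σhat '' O))
    -- the E-function data: distinct points v_k, coefficients P_k = f_k / h_k
    (m : ℕ) (v : Fin m → EuclideanSpace ℝ (Fin (n + 1))) (hv : Function.Injective v)
    (f h : Fin m → MvPolynomial (Fin (n + 1)) ℝ)
    (d : ℤ) (df dh : Fin m → ℕ)
    (hf : ∀ k, (f k).IsHomogeneous (df k)) (hh : ∀ k, (h k).IsHomogeneous (dh k))
    (hd : ∀ k, (df k : ℤ) - (dh k : ℤ) = d)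
    (hhne : ∀ t ∈ O, ∀ k, MvPolynomial.eval (fun i => σ t i) (h k) ≠ 0)
    -- the E-function vanishes on σ(O)
    (hF : ∀ t ∈ O, ∑ k : Fin m,
        ((MvPolynomial.eval (fun i => σ t i) (f k) /
          MvPolynomial.eval (fun i => σ t i) (h k) : ℝ) : ℂ) *
        Complex.exp (-(Complex.I * ((⟪v k, σ t⟫ : ℝ) : ℂ))) = 0) :
    ∀ k, f k = 0 := by
  classical
  set Q : MvPolynomial (Fin n) ℝ := ∏ j, q j with hQdef
  set N : Fin (n + 1) → MvPolynomial (Fin n) ℝ := fun j =>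
    p j * ∏ i ∈ Finset.univ.erase j, q i with hN
  have hQ : ∀ t ∈ O, MvPolynomial.eval (fun i => t i) Q ≠ 0 := by
    intro t ht
    rw [hQdef, map_prod]
    exact Finset.prod_ne_zero_iff.mpr fun j _ => hq t ht j
  have hNev : ∀ t ∈ O, ∀ j, MvPolynomial.eval (fun i => t i) (N j) =
      MvPolynomial.eval (fun i => t i) Q * σ t j := by
    intro t ht j
    rw [hσ, hQdef, ← Finset.mul_prod_erase _ _ (Finset.mem_univ j), hN]
    simp only [map_mul]
    have := hq t ht j
    field_simp
  have haev : ∀ t ∈ O, ∀ (S : MvPolynomial (Fin (n + 1)) ℝ) (e : ℕ), S.IsHomogeneous e →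
      MvPolynomial.eval (fun i => t i) (MvPolynomial.aeval N S) =
        MvPolynomial.eval (fun i => t i) Q ^ e * MvPolynomial.eval (fun i => σ t i) S := by
    intro t ht S e hS
    rw [← hS.eval_mul_left, ← funext fun j => hNev t ht j, MvPolynomial.aeval_def,
      ← MvPolynomial.coe_eval₂Hom, ← RingHom.comp_apply]
    congr 1
    ext i <;> simp
  set G : Fin m → MvPolynomial (Fin n) ℝ := fun k => ∑ j, MvPolynomial.C (v k j) * N j with hGdef
  have hGev : ∀ t ∈ O, ∀ k, MvPolynomial.eval (fun i => t i) (G k) =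
      MvPolynomial.eval (fun i => t i) Q * ⟪v k, σ t⟫ := by
    intro t ht k
    simp only [hGdef, map_sum, map_mul, MvPolynomial.eval_C, hNev t ht, PiLp.inner_apply,
      RCLike.inner_apply, conj_trivial, Finset.mul_sum]
    exact Finset.sum_congr rfl fun j _ => by ring
  set A : Fin m → MvPolynomial (Fin n) ℝ := fun k => MvPolynomial.aeval N (f k) * Q ^ dh k
  set B : Fin m → MvPolynomial (Fin n) ℝ := fun k => MvPolynomial.aeval N (h k) * Q ^ df k
  have hA : ∀ t ∈ O, ∀ k, MvPolynomial.eval (fun i => t i) (A k) =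
      MvPolynomial.eval (fun i => t i) Q ^ (df k + dh k) *
        MvPolynomial.eval (fun i => σ t i) (f k) := by
    intro t ht k
    rw [map_mul, haev t ht _ _ (hf k), map_pow, pow_add]
    ring
  have hB : ∀ t ∈ O, ∀ k, MvPolynomial.eval (fun i => t i) (B k) =
      MvPolynomial.eval (fun i => t i) Q ^ (df k + dh k) *
        MvPolynomial.eval (fun i => σ t i) (h k) := by
    intro t ht k
    rw [map_mul, haev t ht _ _ (hh k), map_pow, pow_add]
    ring
  have hB0 : ∀ t ∈ O, ∀ k, MvPolynomial.eval (fun i => t i) (B k) ≠ 0 := fun t ht k => by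
    rw [hB t ht]
    exact mul_ne_zero (pow_ne_zero _ (hQ t ht)) (hhne t ht k)
  have hfσ : ∀ k, ∀ t ∈ O, MvPolynomial.eval (fun i => σ t i) (f k) = 0 := by
    intro k t ht
    have key := MvPolynomial.eval_eq_zero_of_sum_mul_cexp_eq_zero G
      (fun k => A k * ∏ l ∈ Finset.univ.erase k, B l) Q O hO hQ ?_ ?_ k t ht
    · rw [map_mul, map_prod, hA t ht] at key
      have h1 := (mul_eq_zero.mp key).resolve_right
        (Finset.prod_ne_zero_iff.mpr fun l _ => hB0 t ht l)
      exact (mul_eq_zero.mp h1).resolve_left (pow_ne_zero _ (hQ t ht))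
    · intro k l hkl c hc
      refine hHyp ⟨v k - v l, c, sub_ne_zero.mpr (hv.ne hkl), fun t ht => ?_⟩
      have h1 := congrArg (MvPolynomial.eval (fun i => t i)) hc
      rw [map_sub, hGev t ht, hGev t ht, map_mul, MvPolynomial.eval_C] at h1
      rw [inner_sub_left]
      exact mul_left_cancel₀ (hQ t ht) (by linear_combination h1)
    · intro t ht
      have h1 := congrArg (((∏ l, MvPolynomial.eval (fun i => t i) (B l) : ℝ) : ℂ) * ·) (hF t ht)
      simp only [Finset.mul_sum, mul_zero] at h1
      rw [← h1]
      refine Finset.sum_congr rfl fun k _ => ?_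
      rw [hGev t ht, mul_div_cancel_left₀ _ (hQ t ht), ← mul_assoc, ← Complex.ofReal_mul]
      congr 2
      rw [map_mul, map_prod, ← Finset.mul_prod_erase _ _ (Finset.mem_univ k), hA t ht, hB t ht]
      have := hhne t ht k
      field_simp
  intro k
  obtain ⟨t₀, -, ht₀⟩ := hInner
  refine (hf k).eq_zero_of_eval_cons_one _ isOpen_interior ⟨_, ht₀⟩ fun y hy => ?_
  obtain ⟨t, ht, rfl⟩ := interior_subset hy
  have h1 := (hf k).eval_mul_left (σ t 0) (Fin.cons 1 fun i => σhat t i)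
  have h2 : (fun i => σ t 0 * (Fin.cons 1 fun i => σhat t i : Fin (n + 1) → ℝ) i) =
      fun i => σ t i := by
    refine funext fun i => Fin.cases ?_ (fun j => ?_) i
    · simp
    · simp [hσhat, mul_div_cancel₀ _ (hσ1 t ht)]
  rw [h2, hfσ k t ht] at h1
  exact (mul_eq_zero.mp h1.symm).resolve_left (pow_ne_zero _ (hσ1 t ht))
end
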